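/- Let (X, μ) be a σ-finite measure space with μ(X) = b ∈ (0, ∞]. Fix 1 < p < ∞, let φ be a non-trivial weight on I_b = (0, b), and let ψ be its dual weight. Then there exist constants c, C > 0, independent of g, such that for every μ-measurable function g on X: c·[ρ_{p',ψ}(g) + (∫_X |g| dμ)/(∫_{I_b} φ(t) dt)^{1/p}] ≤ ρ'_{p,φ}(g) ≤ C·[ρ_{p',ψ}(g) + (∫_X |g| dμ)/(∫_{I_b} φ(t) dt)^{1/p}], where the second term is interpreted as 0 when ∫_{I_b} φ = ∞. -/

import Mathlib

open MeasureTheory Set ENNReal Filter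

noncomputable section

/-- The interval `I_b = (0, b)` for `b ∈ (0, ∞]`, as a subset of `ℝ`. -/
def IbSet (b : ℝ≥0∞) : Set ℝ := {t : ℝ | 0 < t ∧ ENNReal.ofReal t < b}

/-- `∫₀ᵗ φ`. -/
def intPhi (φ : ℝ → ℝ≥0∞) (t : ℝ) : ℝ≥0∞ := ∫⁻ s in Ioo (0 : ℝ) t, φ s

/-- `∫ₜᵇ φ(s) s^(-p) ds`. -/
def tailP (b : ℝ≥0∞) (p : ℝ) (φ : ℝ → ℝ≥0∞) (t : ℝ) : ℝ≥0∞ :=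
  ∫⁻ s in {s : ℝ | t < s ∧ ENNReal.ofReal s < b}, φ s * ENNReal.ofReal (s ^ (-p))

/-- `∫₀ᵗ φ + tᵖ ∫ₜᵇ φ(s) s^(-p) ds`. -/
def DPhi (b : ℝ≥0∞) (p : ℝ) (φ : ℝ → ℝ≥0∞) (t : ℝ) : ℝ≥0∞ :=
  intPhi φ t + ENNReal.ofReal (t ^ p) * tailP b p φ t

/-- The Hardy averaging operator `P`. -/
def Pavg (g : ℝ → ℝ≥0∞) (t : ℝ) : ℝ≥0∞ := (ENNReal.ofReal t)⁻¹ * ∫⁻ s in Ioo (0 : ℝ) t, g s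

/-- The dual Hardy operator `Q`, `(Qg)(t) = ∫ₜᵇ g(s) s⁻¹ ds`. -/
def Qavg (b : ℝ≥0∞) (g : ℝ → ℝ≥0∞) (t : ℝ) : ℝ≥0∞ :=
  ∫⁻ s in {s : ℝ | t < s ∧ ENNReal.ofReal s < b}, g s * (ENNReal.ofReal s)⁻¹

/-- The operator `Q_p`, `(Q_p g)(t) = p t^(p-1) ∫ₜᵇ g(s) s^(-p) ds`. -/
def Qp (b : ℝ≥0∞) (p : ℝ) (g : ℝ → ℝ≥0∞) (t : ℝ) : ℝ≥0∞ :=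
  ENNReal.ofReal (p * t ^ (p - 1)) *
    ∫⁻ s in {s : ℝ | t < s ∧ ENNReal.ofReal s < b}, g s * ENNReal.ofReal (s ^ (-p))

/-- `(PQ_p)(φ)(t) = t⁻¹ [∫₀ᵗ φ + tᵖ ∫ₜᵇ φ(s) s^(-p) ds]`. -/
def PQp (b : ℝ≥0∞) (p : ℝ) (φ : ℝ → ℝ≥0∞) (t : ℝ) : ℝ≥0∞ :=
  (ENNReal.ofReal t)⁻¹ * DPhi b p φ t

/-- A weight on `I_b`: a positive, finite, locally integrable function. -/
def IsWeight (b : ℝ≥0∞) (φ : ℝ → ℝ≥0∞) : Prop :=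
  Measurable φ ∧ (∀ t ∈ IbSet b, 0 < φ t ∧ φ t < ⊤) ∧
    ∀ a c : ℝ, 0 < a → ENNReal.ofReal c < b → ∫⁻ t in Icc a c, φ t < ⊤

/-- A non-trivial weight on `I_b` for the index `p`. -/
def IsNontrivialWeight (b : ℝ≥0∞) (p : ℝ) (φ : ℝ → ℝ≥0∞) : Prop :=
  IsWeight b φ ∧
    (b = ⊤ → ∫⁻ t in Ioi (1 : ℝ), φ t * ENNReal.ofReal (t ^ (-p)) < ⊤) ∧
    tailP b p φ 0 = ⊤

/-- The dual weight `ψ(t) = t^(p+p'-1) (∫₀ᵗ φ)(∫ₜᵇ φ(s)s^(-p) ds)/D(t)^(p'+1)`. -/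
def dualWeight (b : ℝ≥0∞) (p : ℝ) (φ : ℝ → ℝ≥0∞) (t : ℝ) : ℝ≥0∞ :=
  ENNReal.ofReal (t ^ (p + p / (p - 1) - 1)) * intPhi φ t * tailP b p φ t /
    (DPhi b p φ t) ^ (p / (p - 1) + 1)

/-- `ψ = (Pφ)(Q_pφ)/[(PQ_p)(φ)]^(p'+1)`. -/
def dualWeight' (b : ℝ≥0∞) (p : ℝ) (φ : ℝ → ℝ≥0∞) (t : ℝ) : ℝ≥0∞ :=
  Pavg φ t * Qp b p φ t / (PQp b p φ t) ^ (p / (p - 1) + 1)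

/-- The decreasing rearrangement `f*`. -/
def decRearr {α : Type*} [MeasurableSpace α] (μ : Measure α) (f : α → ℝ) (t : ℝ) : ℝ≥0∞ :=
  sInf {l : ℝ≥0∞ | μ {x | l < (‖f x‖₊ : ℝ≥0∞)} ≤ ENNReal.ofReal t}

/-- `f**(t) = t⁻¹ ∫₀ᵗ f*`. -/
def avgRearr {α : Type*} [MeasurableSpace α] (μ : Measure α) (f : α → ℝ) (t : ℝ) : ℝ≥0∞ :=
  (ENNReal.ofReal t)⁻¹ * ∫⁻ s in Ioo (0 : ℝ) t, decRearr μ f s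

/-- The Lorentz Gamma functional `ρ_{p,φ}(f) = (∫_{I_b} f**(t)^p φ(t) dt)^(1/p)`. -/
def rhoGamma {α : Type*} [MeasurableSpace α] (μ : Measure α) (b : ℝ≥0∞) (p : ℝ)
    (φ : ℝ → ℝ≥0∞) (f : α → ℝ) : ℝ≥0∞ :=
  (∫⁻ t in IbSet b, (avgRearr μ f t) ^ p * φ t) ^ (1 / p)

/-- The Stieltjes operator `(Sg)(t) = ∫₀^∞ g(s)/(s+t) ds`. -/
def Sop (g : ℝ → ℝ≥0∞) (t : ℝ) : ℝ≥0∞ :=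
  ∫⁻ s in Ioi (0 : ℝ), g s / ENNReal.ofReal (s + t)

/-- Lebesgue measure on `(0,∞)`. -/
def mu0 : Measure ℝ := volume.restrict (Ioi (0 : ℝ))

/-- Layer cake for `ℝ≥0∞`-valued functions. -/
theorem LG_lcake {Ω : Type*} [MeasurableSpace Ω] (m : Measure Ω) [SFinite m] (F : Ω → ℝ≥0∞)
    (hF : Measurable F) :
    ∫⁻ x, F x ∂m = ∫⁻ l in Ioi (0 : ℝ), m {x | ENNReal.ofReal l < F x} := by
  have key : ∀ a : ℝ≥0∞, ∫⁻ l in Ioi (0 : ℝ), ({l : ℝ | ENNReal.ofReal l < a}.indicator 1 l : ℝ≥0∞)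
      = a := by
    intro a
    have hms : MeasurableSet {l : ℝ | ENNReal.ofReal l < a} :=
      measurableSet_lt ENNReal.measurable_ofReal measurable_const
    rw [lintegral_indicator_one hms, Measure.restrict_apply hms]
    rcases eq_or_ne a ⊤ with rfl | ha
    · have : {l : ℝ | ENNReal.ofReal l < ⊤} ∩ Ioi 0 = Ioi 0 := by
        ext l; simp
      rw [this, Real.volume_Ioi]
    · have : {l : ℝ | ENNReal.ofReal l < a} ∩ Ioi 0 = Ioo 0 a.toReal := by
        ext l
        simp only [mem_inter_iff, mem_ofPred_eq, mem_Ioi, mem_Ioo]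
        constructor
        · rintro ⟨h1, h2⟩
          exact ⟨h2, (ENNReal.ofReal_lt_iff_lt_toReal h2.le ha).1 h1⟩
        · rintro ⟨h1, h2⟩
          exact ⟨(ENNReal.ofReal_lt_iff_lt_toReal h1.le ha).2 h2, h1⟩
      rw [this, Real.volume_Ioo, sub_zero, ENNReal.ofReal_toReal ha]
  have hms2 : MeasurableSet {q : Ω × ℝ | ENNReal.ofReal q.2 < F q.1} :=
    measurableSet_lt (ENNReal.measurable_ofReal.comp measurable_snd) (hF.comp measurable_fst)
  calc ∫⁻ x, F x ∂m
      = ∫⁻ x, (∫⁻ l in Ioi (0 : ℝ), ({l : ℝ | ENNReal.ofReal l < F x}.indicator 1 l : ℝ≥0∞)) ∂m := by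
        simp_rw [key]
    _ = ∫⁻ l in Ioi (0 : ℝ), (∫⁻ x, ({l : ℝ | ENNReal.ofReal l < F x}.indicator 1 l : ℝ≥0∞) ∂m) := by
        apply lintegral_lintegral_swap
        apply Measurable.aemeasurable
        exact (measurable_const (a := (1 : ℝ≥0∞))).indicator hms2
    _ = _ := by
        apply lintegral_congr
        intro l
        have : MeasurableSet {x | ENNReal.ofReal l < F x} := measurableSet_lt measurable_const hF
        rw [← lintegral_indicator_one this]
        rfl

theorem LG_int_pow_Ioo (a : ℝ) (ha : 0 ≤ a) (c : ℝ) (hc : 0 < c) :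
    ∫⁻ u in Ioo (0 : ℝ) a, ENNReal.ofReal (c * u ^ (c - 1)) = ENNReal.ofReal (a ^ c) := by
  have h0 : ∫⁻ u in Ioo (0 : ℝ) a, ENNReal.ofReal (c * u ^ (c - 1)) =
      ∫⁻ u in Ioc (0 : ℝ) a, ENNReal.ofReal (c * u ^ (c - 1)) := by
    rw [restrict_Ioo_eq_restrict_Ioc]
  have hi : IntegrableOn (fun u : ℝ => c * u ^ (c - 1)) (Ioc 0 a) := by
    have := (intervalIntegral.intervalIntegrable_rpow' (a := 0) (b := a) (r := c - 1)
      (by linarith)).const_mul c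
    exact (intervalIntegrable_iff_integrableOn_Ioc_of_le ha).1 this
  rw [h0, ← ofReal_integral_eq_lintegral_ofReal hi]
  · rw [← intervalIntegral.integral_of_le ha, intervalIntegral.integral_const_mul,
      integral_rpow (Or.inl (by linarith))]
    congr 1
    rw [sub_add_cancel, Real.zero_rpow hc.ne']
    field_simp
    ring
  · filter_upwards [ae_restrict_mem measurableSet_Ioc] with u hu
    have := hu.1
    positivity

theorem LG_int_pow_Ioi (a : ℝ) (ha : 0 < a) (c : ℝ) (hc : 0 < c) :
    ∫⁻ u in Ioi a, ENNReal.ofReal (c * u ^ (-c - 1)) = ENNReal.ofReal (a ^ (-c)) := by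
  have hi : IntegrableOn (fun u : ℝ => c * u ^ (-c - 1)) (Ioi a) :=
    (integrableOn_Ioi_rpow_of_lt (by linarith) ha).const_mul c
  rw [← ofReal_integral_eq_lintegral_ofReal hi]
  · rw [integral_const_mul, integral_Ioi_rpow_of_lt (by linarith) ha]
    congr 1
    rw [sub_add_cancel]
    field_simp
  · filter_upwards [ae_restrict_mem measurableSet_Ioi] with u hu
    have : 0 < u := ha.trans hu
    positivity

/-- `N^(-c)` as an integral. -/
theorem LG_negpow (N : ℝ≥0∞) (c : ℝ) (hc : 0 < c) :
    ∫⁻ u in Ioi (0 : ℝ), ({u : ℝ | N < ENNReal.ofReal u}.indicator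
      (fun u => ENNReal.ofReal (c * u ^ (-c - 1))) u : ℝ≥0∞) = N ^ (-c) := by
  have hms : MeasurableSet {u : ℝ | N < ENNReal.ofReal u} :=
      measurableSet_lt measurable_const ENNReal.measurable_ofReal
  rw [lintegral_indicator hms, Measure.restrict_restrict hms]
  rcases eq_or_ne N ⊤ with rfl | hN
  · simp [ENNReal.top_rpow_of_neg (show -c < 0 by linarith)]
  have e : {u : ℝ | N < ENNReal.ofReal u} ∩ Ioi 0 = Ioi N.toReal := by
    ext u
    simp only [mem_inter_iff, mem_ofPred_eq, mem_Ioi]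
    constructor
    · rintro ⟨h1, h2⟩
      exact (ENNReal.lt_ofReal_iff_toReal_lt hN).1 h1
    · intro h
      exact ⟨(ENNReal.lt_ofReal_iff_toReal_lt hN).2 h, ENNReal.toReal_nonneg.trans_lt h⟩
  rw [e]
  rcases eq_or_ne N 0 with rfl | hN0
  · rw [ENNReal.zero_rpow_of_neg (by linarith), ENNReal.toReal_zero]
    by_contra hne
    -- lower bounds `a^(-c)` blow up
    have hle : ∀ a : ℝ, 0 < a → ENNReal.ofReal (a ^ (-c)) ≤
        ∫⁻ u in Ioi (0:ℝ), ENNReal.ofReal (c * u ^ (-c - 1)) := by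
      intro a ha
      rw [← LG_int_pow_Ioi a ha c hc]
      exact lintegral_mono_set (Ioi_subset_Ioi ha.le)
    set L := ∫⁻ u in Ioi (0:ℝ), ENNReal.ofReal (c * u ^ (-c - 1)) with hL
    have h1 := hle ((L.toReal + 1) ^ (-c⁻¹)) (by positivity)
    rw [← Real.rpow_mul (by positivity)] at h1
    have : -c⁻¹ * -c = 1 := by field_simp
    rw [this, Real.rpow_one, ENNReal.ofReal_le_iff_le_toReal hne] at h1
    linarith
  · have hpos : 0 < N.toReal := ENNReal.toReal_pos hN0 hN
    rw [LG_int_pow_Ioi _ hpos c hc, ← ENNReal.ofReal_rpow_of_pos hpos, ENNReal.ofReal_toReal hN]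

theorem LG_negpow_int {Ω : Type*} [MeasurableSpace Ω] (m : Measure Ω) [SFinite m]
    (N : Ω → ℝ≥0∞) (hN : Measurable N) (c : ℝ) (hc : 0 < c) :
    ∫⁻ x, N x ^ (-c) ∂m = ∫⁻ u in Ioi (0 : ℝ), ENNReal.ofReal (c * u ^ (-c - 1)) *
      m {x | N x < ENNReal.ofReal u} := by
  have hms2 : MeasurableSet {q : Ω × ℝ | N q.1 < ENNReal.ofReal q.2} :=
    measurableSet_lt (hN.comp measurable_fst) (ENNReal.measurable_ofReal.comp measurable_snd)
  have hm1 : Measurable (fun u : ℝ => ENNReal.ofReal (c * u ^ (-c - 1))) := by fun_prop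
  calc ∫⁻ x, N x ^ (-c) ∂m
      = ∫⁻ x, (∫⁻ u in Ioi (0 : ℝ), ({u : ℝ | N x < ENNReal.ofReal u}.indicator
      (fun u => ENNReal.ofReal (c * u ^ (-c - 1))) u : ℝ≥0∞)) ∂m := by
        simp_rw [LG_negpow _ c hc]
    _ = ∫⁻ u in Ioi (0 : ℝ), (∫⁻ x, ({u : ℝ | N x < ENNReal.ofReal u}.indicator
      (fun u => ENNReal.ofReal (c * u ^ (-c - 1))) u : ℝ≥0∞) ∂m) := by
        apply lintegral_lintegral_swap
        apply Measurable.aemeasurable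
        exact (hm1.comp measurable_snd).indicator hms2
    _ = _ := by
        apply lintegral_congr
        intro u
        have hm : MeasurableSet {x | N x < ENNReal.ofReal u} := measurableSet_lt hN measurable_const
        rw [← lintegral_indicator_const hm]
        rfl

/-- (ii): tail bound. -/
theorem LG_tail {Ω : Type*} [MeasurableSpace Ω] (m : Measure Ω) [SFinite m]
    (N : Ω → ℝ≥0∞) (hN : Measurable N) (hcum : ∀ u : ℝ≥0∞, m {x | N x < u} ≤ u)
    (β : ℝ) (hβ : 0 < β) (S : Set Ω) (hS : MeasurableSet S) (t0 : ℝ≥0∞) (h0 : t0 ≠ 0) (h1 : t0 ≠ ⊤)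
    (hSt : ∀ x ∈ S, t0 ≤ N x) :
    ∫⁻ x in S, N x ^ (-(1 + β)) ∂m ≤ ENNReal.ofReal ((1 + β) / β) * t0 ^ (-β) := by
  rw [LG_negpow_int (m.restrict S) N hN (1 + β) (by linarith)]
  have hpos : 0 < t0.toReal := ENNReal.toReal_pos h0 h1
  calc _ ≤ ∫⁻ u in Ioi (0 : ℝ), (Ioi t0.toReal).indicator
          (fun u => ENNReal.ofReal ((1 + β) / β) * ENNReal.ofReal (β * u ^ (-β - 1))) u := by
        apply setLIntegral_mono' measurableSet_Ioi
        intro u hu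
        have hu' : (0:ℝ) < u := hu
        have hms : MeasurableSet {x | N x < ENNReal.ofReal u} := measurableSet_lt hN measurable_const
        rw [Measure.restrict_apply hms]
        by_cases hut : t0.toReal < u
        · rw [indicator_of_mem (by exact hut)]
          calc _ ≤ ENNReal.ofReal ((1 + β) * u ^ (-(1 + β) - 1)) * ENNReal.ofReal u := by
                gcongr
                exact (measure_mono inter_subset_left).trans (hcum _)
            _ = _ := by
                rw [← ENNReal.ofReal_mul (by positivity), ← ENNReal.ofReal_mul (by positivity)]
                congr 1
                have : u ^ (-(1+β) - 1) * u = u ^ (-β - 1) := by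
                  rw [← Real.rpow_add_one hu'.ne']; congr 1; ring
                rw [mul_assoc, this]; field_simp
        · rw [indicator_of_notMem (by exact hut)]
          have : {x | N x < ENNReal.ofReal u} ∩ S = ∅ := by
            ext x
            simp only [mem_inter_iff, mem_ofPred_eq, mem_empty_iff_false, iff_false, not_and]
            intro hx hxS
            have := (hSt x hxS).trans_lt hx
            rw [ENNReal.lt_ofReal_iff_toReal_lt h1] at this
            exact hut this
          rw [this]; simp
    _ = ENNReal.ofReal ((1 + β) / β) * t0 ^ (-β) := by
        rw [lintegral_indicator measurableSet_Ioi, Measure.restrict_restrict measurableSet_Ioi]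
        have : Ioi t0.toReal ∩ Ioi 0 = Ioi t0.toReal := by
          rw [Ioi_inter_Ioi, max_eq_left hpos.le]
        rw [this, lintegral_const_mul _ (by fun_prop), LG_int_pow_Ioi _ hpos β hβ,
          ← ENNReal.ofReal_rpow_of_pos hpos, ENNReal.ofReal_toReal h1]

/-- (i): head bound. -/
theorem LG_head {Ω : Type*} [MeasurableSpace Ω] (m : Measure Ω) [SFinite m]
    (N : Ω → ℝ≥0∞) (hN : Measurable N) (hcum : ∀ u : ℝ≥0∞, m {x | N x < u} ≤ u)
    (α : ℝ) (hα : 0 < α) (hα1 : α < 1) (S : Set Ω) (hS : MeasurableSet S) (M : ℝ≥0∞)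
    (h1 : M ≠ ⊤) (hSM : m S ≤ M) :
    ∫⁻ x in S, N x ^ (-α) ∂m ≤ ENNReal.ofReal (α / (1 - α) + 1) * M ^ (1 - α) := by
  rcases eq_or_ne M 0 with rfl | h0
  · have : m S = 0 := le_antisymm hSM bot_le
    rw [Measure.restrict_eq_zero.2 this]; simp
  rw [LG_negpow_int (m.restrict S) N hN α hα]
  have hpos : 0 < M.toReal := ENNReal.toReal_pos h0 h1
  have hc : 0 < 1 - α := by linarith
  rw [← Ioc_union_Ioi_eq_Ioi hpos.le]
  refine (lintegral_union_le _ _ _).trans ?_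
  rw [ENNReal.ofReal_add (by positivity) (by positivity), add_mul]
  gcongr
  · calc _ ≤ ∫⁻ u in Ioc (0 : ℝ) M.toReal, ENNReal.ofReal (α / (1 - α)) *
          ENNReal.ofReal ((1 - α) * u ^ ((1 - α) - 1)) := by
          apply setLIntegral_mono' measurableSet_Ioc
          intro u hu
          have hu' : (0:ℝ) < u := hu.1
          calc _ ≤ ENNReal.ofReal (α * u ^ (-α - 1)) * ENNReal.ofReal u := by
                gcongr
                exact (Measure.restrict_apply_le _ _).trans (hcum _)
            _ = _ := by
                rw [← ENNReal.ofReal_mul (by positivity), ← ENNReal.ofReal_mul (by positivity)]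
                congr 1
                have : u ^ (-α - 1) * u = u ^ (1 - α - 1) := by
                  rw [← Real.rpow_add_one hu'.ne']; congr 1; ring
                rw [mul_assoc, this]; field_simp
      _ = _ := by
          rw [lintegral_const_mul _ (by fun_prop), ← restrict_Ioo_eq_restrict_Ioc,
            LG_int_pow_Ioo _ hpos.le _ hc, ← ENNReal.ofReal_rpow_of_pos hpos,
            ENNReal.ofReal_toReal h1]
  · calc _ ≤ ∫⁻ u in Ioi M.toReal, ENNReal.ofReal (α * u ^ (-α - 1)) * M := by
          apply setLIntegral_mono' measurableSet_Ioi
          intro u hu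
          gcongr
          refine (measure_mono (subset_univ _)).trans ?_
          simpa using hSM
      _ = _ := by
          rw [lintegral_mul_const _ (by fun_prop), LG_int_pow_Ioi _ hpos α hα,
            ← ENNReal.ofReal_rpow_of_pos hpos, ENNReal.ofReal_toReal h1]
          rw [ENNReal.ofReal_one, one_mul]
          nth_rw 2 [← ENNReal.rpow_one M]
          rw [← ENNReal.rpow_add _ _ h0 h1]; congr 1; ring

/-- cumulative function of an atomless measure. -/
theorem LG_cum (m : Measure ℝ) [NullSingletonClass m] (u : ℝ≥0∞) : m {t | m (Iio t) < u} ≤ u := by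
  set L := {t | m (Iio t) < u} with hL
  have hlow : ∀ t ∈ L, ∀ s ≤ t, s ∈ L := fun t ht s hs =>
    (measure_mono (Iio_subset_Iio hs)).trans_lt ht
  rcases L.eq_empty_or_nonempty with hne | hne
  · rw [hne]; simp
  by_cases hb : BddAbove L
  · have hsub : ∀ t < sSup L, m (Iio t) ≤ u := by
      intro t ht
      obtain ⟨x, hx, htx⟩ := exists_lt_of_lt_csSup hne ht
      exact (hlow x hx t htx.le).le
    obtain ⟨v, hv, hvlt, hvt⟩ := exists_seq_strictMono_tendsto (sSup L)
    have hU : Iio (sSup L) = ⋃ n, Iio (v n) := by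
      ext x
      simp only [mem_Iio, mem_iUnion]
      constructor
      · intro hx
        exact (hvt.eventually (lt_mem_nhds hx)).exists
      · rintro ⟨n, hn⟩
        exact hn.trans (hvlt n)
    calc m L ≤ m (Iic (sSup L)) := measure_mono (fun x hx => le_csSup hb hx)
      _ = m (Iio (sSup L)) := measure_congr Iio_ae_eq_Iic.symm
      _ ≤ u := by
        rw [hU, Monotone.measure_iUnion (fun i j hij => Iio_subset_Iio (hv.monotone hij))]
        exact iSup_le fun n => hsub _ (hvlt n)
  · have hall : ∀ t, m (Iio t) ≤ u := by
      intro t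
      rw [not_bddAbove_iff] at hb
      obtain ⟨x, hx, htx⟩ := hb t
      exact (hlow x hx t htx.le).le
    have hU : (univ : Set ℝ) = ⋃ n : ℕ, Iio (n : ℝ) := by
      ext x
      simp only [mem_univ, mem_iUnion, mem_Iio, true_iff]
      exact exists_nat_gt x
    calc m L ≤ m univ := measure_mono (subset_univ _)
      _ ≤ u := by
        rw [hU, Monotone.measure_iUnion (fun i j hij => Iio_subset_Iio (by exact_mod_cast hij))]
        exact iSup_le fun n => hall _

theorem LG_cum' (m : Measure ℝ) [NullSingletonClass m] (u : ℝ≥0∞) : m {t | m (Ioi t) < u} ≤ u := by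
  have hneg : MeasurePreserving (fun x : ℝ => -x) m (m.map (fun x : ℝ => -x)) :=
    ⟨measurable_neg, rfl⟩
  set m' := m.map (fun x : ℝ => -x) with hm'
  have happ : ∀ S : Set ℝ, m' S = m ((fun x : ℝ => -x) ⁻¹' S) := fun S =>
    (MeasurableEquiv.neg ℝ).map_apply S
  haveI : NullSingletonClass m' := ⟨fun x => by
    rw [happ]
    have : (fun x : ℝ => -x) ⁻¹' {x} = {-x} := by
      ext y; simp [neg_eq_iff_eq_neg]
    rw [this]; exact measure_singleton _⟩
  have h := LG_cum m' u
  have e : ∀ t, m' (Iio t) = m (Ioi (-t)) := by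
    intro t; rw [happ]; congr 1; ext y; simp [neg_lt]
  rw [happ] at h
  convert h using 2
  ext t
  simp [e]

/-- weighted Jensen/Hölder. -/
theorem LG_jensen {Y : Type*} [MeasurableSpace Y] (n : Measure Y) (q : ℝ) (hq : 1 < q)
    (a U : Y → ℝ≥0∞) (ha : Measurable a) (hU : Measurable U) :
    (∫⁻ y, a y * U y ∂n) ^ q ≤ (∫⁻ y, a y ∂n) ^ (q - 1) * ∫⁻ y, a y * U y ^ q ∂n := by
  have hq0 : 0 < q := by linarith
  have hconj : (q / (q - 1)).HolderConjugate q := (Real.HolderConjugate.conjExponent hq).symm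
  have hq1 : 0 < q - 1 := by linarith
  have hq'0 : 0 < q / (q - 1) := by positivity
  have h := ENNReal.lintegral_mul_le_Lp_mul_Lq n hconj
    (f := fun y => a y ^ (1 / (q / (q - 1)))) (g := fun y => a y ^ (1 / q) * U y)
    (by fun_prop) (by fun_prop)
  have e1 : ∀ y, ((fun y => a y ^ (1 / (q / (q - 1)))) * fun y => a y ^ (1 / q) * U y) y =
      a y * U y := by
    intro y
    simp only [Pi.mul_apply]
    rw [← mul_assoc, ← ENNReal.rpow_add_of_nonneg _ _ (by positivity) (by positivity)]
    have : 1 / (q / (q - 1)) + 1 / q = 1 := by field_simp; ring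
    rw [this, ENNReal.rpow_one]
  have e2 : ∀ y, (a y ^ (1 / (q / (q - 1)))) ^ (q / (q - 1)) = a y := by
    intro y; rw [← ENNReal.rpow_mul, one_div_mul_cancel hq'0.ne', ENNReal.rpow_one]
  have e3 : ∀ y, (a y ^ (1 / q) * U y) ^ q = a y * U y ^ q := by
    intro y; rw [ENNReal.mul_rpow_of_nonneg _ _ hq0.le, ← ENNReal.rpow_mul,
      one_div_mul_cancel hq0.ne', ENNReal.rpow_one]
  simp only [e1, e2, e3] at h
  calc _ ≤ _ := ENNReal.rpow_le_rpow h hq0.le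
    _ = _ := by
      rw [ENNReal.mul_rpow_of_nonneg _ _ hq0.le, ← ENNReal.rpow_mul, ← ENNReal.rpow_mul,
        one_div_mul_cancel hq0.ne', ENNReal.rpow_one]
      congr 2; field_simp

theorem LG_schur {Y Z : Type*} [MeasurableSpace Y] [MeasurableSpace Z] (n : Measure Y)
    (m : Measure Z) [SFinite n] [SFinite m] (S : Set (Z × Y)) (hS : MeasurableSet S)
    (q : ℝ) (hq : 1 < q) (A U : Y → ℝ≥0∞) (B : Z → ℝ≥0∞) (hA : Measurable A) (hU : Measurable U)
    (hB : Measurable B) (C1 C2 : ℝ≥0∞)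
    (h1 : ∀ᵐ z ∂m, ∫⁻ y in {y | (z, y) ∈ S}, A y ^ (-(1 / q)) ∂n ≤ C1 * B z ^ (-(1 / q)))
    (h2 : ∀ᵐ y ∂n, ∫⁻ z in {z | (z, y) ∈ S}, B z ^ (-(1 - 1 / q)) ∂m ≤ C2 * A y ^ (1 / q)) :
    ∫⁻ z, (∫⁻ y in {y | (z, y) ∈ S}, A y ^ (-(1 / q)) * U y ∂n) ^ q ∂m ≤
      C1 ^ (q - 1) * C2 * ∫⁻ y, U y ^ q ∂n := by
  have hq0 : 0 < q := by linarith
  have hSz : ∀ z, MeasurableSet {y | (z, y) ∈ S} := fun z => measurable_prodMk_left hS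
  have hSy : ∀ y, MeasurableSet {z | (z, y) ∈ S} := fun y => measurable_prodMk_right hS
  have hUq : Measurable fun y => A y ^ (-(1 / q)) * U y ^ q := by fun_prop
  have hBq : Measurable fun z => B z ^ (-(1 - 1 / q)) := by fun_prop
  have hmeas : Measurable (Function.uncurry fun z y =>
      S.indicator (fun w : Z × Y => B w.1 ^ (-(1 - 1 / q)) * (A w.2 ^ (-(1 / q)) * U w.2 ^ q))
        (z, y)) :=
    ((hBq.comp measurable_fst).mul (hUq.comp measurable_snd)).indicator hS
  calc _ ≤ ∫⁻ z, C1 ^ (q - 1) * ∫⁻ y, S.indicator (fun w : Z × Y => B w.1 ^ (-(1 - 1 / q)) *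
            (A w.2 ^ (-(1 / q)) * U w.2 ^ q)) (z, y) ∂n ∂m := by
        apply lintegral_mono_ae
        filter_upwards [h1] with z hz
        refine (LG_jensen _ q hq _ U (by fun_prop) hU).trans ?_
        calc _ ≤ (C1 * B z ^ (-(1 / q))) ^ (q - 1) *
              ∫⁻ y in {y | (z, y) ∈ S}, A y ^ (-(1 / q)) * U y ^ q ∂n := by
              gcongr
          _ = C1 ^ (q - 1) * (B z ^ (-(1 - 1 / q)) *
              ∫⁻ y in {y | (z, y) ∈ S}, A y ^ (-(1 / q)) * U y ^ q ∂n) := by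
              rw [ENNReal.mul_rpow_of_nonneg _ _ (by linarith), ← ENNReal.rpow_mul, mul_assoc]
              congr 3
              field_simp
          _ = _ := by
              rw [← lintegral_const_mul _ hUq, ← lintegral_indicator (hSz z)]
              rfl
    _ = C1 ^ (q - 1) * ∫⁻ y, ∫⁻ z, S.indicator (fun w : Z × Y => B w.1 ^ (-(1 - 1 / q)) *
            (A w.2 ^ (-(1 / q)) * U w.2 ^ q)) (z, y) ∂m ∂n := by
        rw [lintegral_const_mul _ hmeas.lintegral_prod_right,
          lintegral_lintegral_swap hmeas.aemeasurable]
    _ ≤ C1 ^ (q - 1) * ∫⁻ y, C2 * U y ^ q ∂n := by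
        gcongr 1
        apply lintegral_mono_ae
        filter_upwards [h2] with y hy
        calc _ = (∫⁻ z in {z | (z, y) ∈ S}, B z ^ (-(1 - 1 / q)) ∂m) *
                (A y ^ (-(1 / q)) * U y ^ q) := by
              rw [← lintegral_mul_const _ hBq, ← lintegral_indicator (hSy y)]
              rfl
          _ ≤ C2 * A y ^ (1 / q) * (A y ^ (-(1 / q)) * U y ^ q) := by gcongr
          _ = C2 * ((A y ^ (1 / q) * (A y ^ (1 / q))⁻¹) * U y ^ q) := by
              rw [ENNReal.rpow_neg]; ring
          _ ≤ C2 * (1 * U y ^ q) := by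
              gcongr
              exact ENNReal.mul_inv_le_one _
          _ = _ := by rw [one_mul]
    _ = _ := by
        rw [lintegral_const_mul _ (by fun_prop), mul_assoc]

theorem LG_intPhi_eq (d : ℝ → ℝ≥0∞) (t : ℝ) :
    ((volume.restrict (Ioi (0 : ℝ))).withDensity d) (Iio t) = intPhi d t := by
  rw [withDensity_apply _ measurableSet_Iio, Measure.restrict_restrict measurableSet_Iio,
    Iio_inter_Ioi]; rfl

theorem LG_intPhi_mono (d : ℝ → ℝ≥0∞) : Monotone (intPhi d) := fun _ _ h =>
  lintegral_mono_set (Ioo_subset_Ioo_right h)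

theorem LG_inc_tail (d : ℝ → ℝ≥0∞) (hd : Measurable d) (β : ℝ) (hβ : 0 < β) (t : ℝ) (ht : 0 ≤ t)
    (h0 : intPhi d t ≠ 0) (h1 : intPhi d t ≠ ⊤) :
    ∫⁻ r in Ioi t, intPhi d r ^ (-(1 + β)) * d r ≤
      ENNReal.ofReal ((1 + β) / β) * intPhi d t ^ (-β) := by
  set m := (volume.restrict (Ioi (0 : ℝ))).withDensity d with hm
  have hmon := LG_intPhi_mono d
  have h := LG_tail m (intPhi d) hmon.measurable
    (fun u => by simpa only [hm, LG_intPhi_eq] using LG_cum m u) β hβ (Ioi t) measurableSet_Ioi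
    (intPhi d t) h0 h1 (fun x hx => hmon (le_of_lt hx))
  rw [hm, restrict_withDensity measurableSet_Ioi, Measure.restrict_restrict measurableSet_Ioi,
    Ioi_inter_Ioi, max_eq_left ht, lintegral_withDensity_eq_lintegral_mul _ hd
      (by have := hmon.measurable; fun_prop)] at h
  simpa only [Pi.mul_apply, mul_comm (d _)] using h

theorem LG_inc_head (d : ℝ → ℝ≥0∞) (hd : Measurable d) (α : ℝ) (hα : 0 < α) (hα1 : α < 1) (t : ℝ)
    (h1 : intPhi d t ≠ ⊤) :
    ∫⁻ r in Ioo 0 t, intPhi d r ^ (-α) * d r ≤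
      ENNReal.ofReal (α / (1 - α) + 1) * intPhi d t ^ (1 - α) := by
  set m := (volume.restrict (Ioi (0 : ℝ))).withDensity d with hm
  have hmon := LG_intPhi_mono d
  have h := LG_head m (intPhi d) hmon.measurable
    (fun u => by simpa only [hm, LG_intPhi_eq] using LG_cum m u) α hα hα1 (Iio t) measurableSet_Iio
    (intPhi d t) h1 (by rw [hm, LG_intPhi_eq])
  rw [hm, restrict_withDensity measurableSet_Iio, Measure.restrict_restrict measurableSet_Iio,
    Iio_inter_Ioi, lintegral_withDensity_eq_lintegral_mul _ hd
      (by have := hmon.measurable; fun_prop)] at h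
  simpa only [Pi.mul_apply, mul_comm (d _)] using h

/-- upper tail integral -/
def LGtail (d : ℝ → ℝ≥0∞) (t : ℝ) : ℝ≥0∞ := ∫⁻ s in Ioi t, d s

theorem LGtail_anti (d : ℝ → ℝ≥0∞) : Antitone (LGtail d) := fun _ _ h =>
  lintegral_mono_set (Ioi_subset_Ioi h)

theorem LG_tail_eq (d : ℝ → ℝ≥0∞) (t : ℝ) : ((volume : Measure ℝ).withDensity d) (Ioi t) = LGtail d t := by
  rw [withDensity_apply _ measurableSet_Ioi]; rfl

theorem LG_dec_tail (d : ℝ → ℝ≥0∞) (hd : Measurable d) (β : ℝ) (hβ : 0 < β) (t : ℝ)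
    (h0 : LGtail d t ≠ 0) (h1 : LGtail d t ≠ ⊤) :
    ∫⁻ r in Iio t, LGtail d r ^ (-(1 + β)) * d r ≤
      ENNReal.ofReal ((1 + β) / β) * LGtail d t ^ (-β) := by
  set m := (volume : Measure ℝ).withDensity d with hm
  have hmon := LGtail_anti d
  have h := LG_tail m (LGtail d) hmon.measurable
    (fun u => by simpa only [hm, LG_tail_eq] using LG_cum' m u) β hβ (Iio t) measurableSet_Iio
    (LGtail d t) h0 h1 (fun x hx => hmon (le_of_lt hx))
  rw [hm, restrict_withDensity measurableSet_Iio, lintegral_withDensity_eq_lintegral_mul _ hd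
      (by have := hmon.measurable; fun_prop)] at h
  simpa only [Pi.mul_apply, mul_comm (d _)] using h

theorem LG_dec_head (d : ℝ → ℝ≥0∞) (hd : Measurable d) (α : ℝ) (hα : 0 < α) (hα1 : α < 1) (t : ℝ)
    (h1 : LGtail d t ≠ ⊤) :
    ∫⁻ r in Ioi t, LGtail d r ^ (-α) * d r ≤
      ENNReal.ofReal (α / (1 - α) + 1) * LGtail d t ^ (1 - α) := by
  set m := (volume : Measure ℝ).withDensity d with hm
  have hmon := LGtail_anti d
  have h := LG_head m (LGtail d) hmon.measurable
    (fun u => by simpa only [hm, LG_tail_eq] using LG_cum' m u) α hα hα1 (Ioi t) measurableSet_Ioi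
    (LGtail d t) h1 (by rw [hm, LG_tail_eq])
  rw [hm, restrict_withDensity measurableSet_Ioi, lintegral_withDensity_eq_lintegral_mul _ hd
      (by have := hmon.measurable; fun_prop)] at h
  simpa only [Pi.mul_apply, mul_comm (d _)] using h

theorem LG_fub1 (c w : ℝ → ℝ≥0∞) (hc : Measurable c) (hw : Measurable w) (t : ℝ) :
    ∫⁻ r in Ioo 0 t, c r * ∫⁻ s in Ioi r, w s =
      ∫⁻ s in Ioi 0, w s * ∫⁻ r in Ioo 0 (min s t), c r := by
  have hS : MeasurableSet {q : ℝ × ℝ | q.1 < q.2} := measurableSet_lt measurable_fst measurable_snd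
  have hmeas : Measurable (Function.uncurry fun r s : ℝ =>
      {q : ℝ × ℝ | q.1 < q.2}.indicator (fun q => c q.1 * w q.2) (r, s)) :=
    ((hc.comp measurable_fst).mul (hw.comp measurable_snd)).indicator hS
  calc _ = ∫⁻ r in Ioo 0 t, ∫⁻ s in Ioi (0:ℝ),
        {q : ℝ × ℝ | q.1 < q.2}.indicator (fun q => c q.1 * w q.2) (r, s) := by
        apply setLIntegral_congr_fun measurableSet_Ioo
        intro r hr
        have : Ioi r = Ioi r ∩ Ioi 0 := by rw [Ioi_inter_Ioi, max_eq_left hr.1.le]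
        simp only []
        rw [this, ← Measure.restrict_restrict measurableSet_Ioi, ← lintegral_const_mul _ hw,
          ← lintegral_indicator measurableSet_Ioi]
        rfl
    _ = ∫⁻ s in Ioi (0:ℝ), ∫⁻ r in Ioo 0 t,
        {q : ℝ × ℝ | q.1 < q.2}.indicator (fun q => c q.1 * w q.2) (r, s) :=
        lintegral_lintegral_swap hmeas.aemeasurable
    _ = _ := by
        apply lintegral_congr
        intro s
        have : Ioo 0 (min s t) = Iio s ∩ Ioo 0 t := by
          ext x; simp only [mem_Ioo, mem_inter_iff, mem_Iio, lt_min_iff]; tauto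
        rw [this, ← Measure.restrict_restrict measurableSet_Iio, ← lintegral_const_mul _ hc,
          ← lintegral_indicator measurableSet_Iio]
        apply lintegral_congr
        intro r
        simp only [indicator, mem_ofPred_eq, mem_Iio, mul_comm]

theorem LG_fub2 (c w : ℝ → ℝ≥0∞) (hc : Measurable c) (hw : Measurable w) (t : ℝ) :
    ∫⁻ r in Ioi t, c r * ∫⁻ s in Ioo 0 r, w s =
      ∫⁻ s in Ioi 0, w s * ∫⁻ r in Ioi (max s t), c r := by
  have hS : MeasurableSet {q : ℝ × ℝ | q.2 < q.1} := measurableSet_lt measurable_snd measurable_fst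
  have hmeas : Measurable (Function.uncurry fun r s : ℝ =>
      {q : ℝ × ℝ | q.2 < q.1}.indicator (fun q => c q.1 * w q.2) (r, s)) :=
    ((hc.comp measurable_fst).mul (hw.comp measurable_snd)).indicator hS
  calc _ = ∫⁻ r in Ioi t, ∫⁻ s in Ioi (0:ℝ),
        {q : ℝ × ℝ | q.2 < q.1}.indicator (fun q => c q.1 * w q.2) (r, s) := by
        apply lintegral_congr
        intro r
        have : Ioo 0 r = Iio r ∩ Ioi 0 := by rw [Iio_inter_Ioi]
        rw [this, ← Measure.restrict_restrict measurableSet_Iio, ← lintegral_const_mul _ hw,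
          ← lintegral_indicator measurableSet_Iio]
        rfl
    _ = ∫⁻ s in Ioi (0:ℝ), ∫⁻ r in Ioi t,
        {q : ℝ × ℝ | q.2 < q.1}.indicator (fun q => c q.1 * w q.2) (r, s) :=
        lintegral_lintegral_swap hmeas.aemeasurable
    _ = _ := by
        apply lintegral_congr
        intro s
        rw [← Ioi_inter_Ioi, ← Measure.restrict_restrict measurableSet_Ioi, ← lintegral_const_mul _ hc,
          ← lintegral_indicator (s := Ioi s) measurableSet_Ioi]
        apply lintegral_congr
        intro r
        simp only [indicator, mem_ofPred_eq, mem_Ioi, mul_comm]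

def LGw (p : ℝ) (φ : ℝ → ℝ≥0∞) (s : ℝ) : ℝ≥0∞ := φ s * ENNReal.ofReal (s ^ (-p))
def LGW (p : ℝ) (φ : ℝ → ℝ≥0∞) (t : ℝ) : ℝ≥0∞ := LGtail (LGw p φ) t
def LGD (p : ℝ) (φ : ℝ → ℝ≥0∞) (t : ℝ) : ℝ≥0∞ := intPhi φ t + ENNReal.ofReal (t ^ p) * LGW p φ t
def LGE (p : ℝ) (φ : ℝ → ℝ≥0∞) (t : ℝ) : ℝ≥0∞ := ENNReal.ofReal (t ^ (-p)) * intPhi φ t + LGW p φ t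
def LGd (p : ℝ) (φ : ℝ → ℝ≥0∞) (r : ℝ) : ℝ≥0∞ := ENNReal.ofReal (p * r ^ (p - 1)) * LGW p φ r
def LGe (p : ℝ) (φ : ℝ → ℝ≥0∞) (r : ℝ) : ℝ≥0∞ := ENNReal.ofReal (p * r ^ (-p - 1)) * intPhi φ r
/-- the discretizing density -/
def LGn (p : ℝ) (φ : ℝ → ℝ≥0∞) (r : ℝ) : ℝ≥0∞ :=
  ENNReal.ofReal (r ^ (p - 1)) * intPhi φ r * LGW p φ r * (LGD p φ r) ^ (-2 : ℝ)

section
variable {p : ℝ} {φ : ℝ → ℝ≥0∞}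

theorem LGw_meas (hφ : Measurable φ) : Measurable (LGw p φ) := by unfold LGw; fun_prop
theorem LGV_meas : Measurable (intPhi φ) := (LG_intPhi_mono φ).measurable
theorem LGW_meas : Measurable (LGW p φ) := (LGtail_anti _).measurable
theorem LGD_meas : Measurable (LGD p φ) := by
  have := LGV_meas (φ := φ); have := LGW_meas (p := p) (φ := φ); unfold LGD; fun_prop
theorem LGE_meas : Measurable (LGE p φ) := by
  have := LGV_meas (φ := φ); have := LGW_meas (p := p) (φ := φ); unfold LGE; fun_prop
theorem LGd_meas : Measurable (LGd p φ) := by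
  have := LGW_meas (p := p) (φ := φ); unfold LGd; fun_prop
theorem LGe_meas : Measurable (LGe p φ) := by
  have := LGV_meas (φ := φ); unfold LGe; fun_prop
theorem LGn_meas : Measurable (LGn p φ) := by
  have := LGV_meas (φ := φ); have := LGW_meas (p := p) (φ := φ)
  have := LGD_meas (p := p) (φ := φ); unfold LGn; fun_prop

theorem LGD_eq (hp : 0 < p) (hφ : Measurable φ) {t : ℝ} (ht : 0 < t) :
    LGD p φ t = intPhi (LGd p φ) t := by
  have h := LG_fub1 (fun r => ENNReal.ofReal (p * r ^ (p - 1))) (LGw p φ) (by fun_prop)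
    (LGw_meas hφ) t
  have e : intPhi (LGd p φ) t = ∫⁻ s in Ioi 0, LGw p φ s *
      ∫⁻ r in Ioo 0 (min s t), ENNReal.ofReal (p * r ^ (p - 1)) := h
  rw [e, ← Ioo_union_Ici_eq_Ioi ht, lintegral_union measurableSet_Ici
    (by rw [Set.disjoint_left]; intro x hx hx'; exact absurd hx.2 (not_lt.2 hx'))]
  unfold LGD
  congr 1
  · unfold intPhi
    apply setLIntegral_congr_fun measurableSet_Ioo
    intro s hs
    simp only []
    rw [min_eq_left hs.2.le, LG_int_pow_Ioo s hs.1.le p hp]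
    unfold LGw
    rw [mul_assoc, ← ENNReal.ofReal_mul (by have := hs.1; positivity), ← Real.rpow_add hs.1]
    simp
  · unfold LGW LGtail
    rw [← restrict_Ioi_eq_restrict_Ici, ← lintegral_const_mul _ (LGw_meas hφ)]
    apply setLIntegral_congr_fun measurableSet_Ioi
    intro s hs
    simp only []
    rw [min_eq_right (le_of_lt hs), LG_int_pow_Ioo t ht.le p hp, mul_comm]

theorem LGE_eq (hp : 0 < p) (hφ : Measurable φ) {t : ℝ} (ht : 0 < t) :
    LGE p φ t = LGtail (LGe p φ) t := by
  have h := LG_fub2 (fun r => ENNReal.ofReal (p * r ^ (-p - 1))) φ (by fun_prop) hφ t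
  have e : LGtail (LGe p φ) t = ∫⁻ s in Ioi 0, φ s *
      ∫⁻ r in Ioi (max s t), ENNReal.ofReal (p * r ^ (-p - 1)) := h
  rw [e, ← Ioo_union_Ici_eq_Ioi ht, lintegral_union measurableSet_Ici
    (by rw [Set.disjoint_left]; intro x hx hx'; exact absurd hx.2 (not_lt.2 hx'))]
  unfold LGE
  congr 1
  · unfold intPhi
    rw [← lintegral_const_mul _ hφ]
    apply setLIntegral_congr_fun measurableSet_Ioo
    intro s hs
    simp only []
    rw [max_eq_right hs.2.le, LG_int_pow_Ioi t ht p hp, mul_comm]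
  · unfold LGW LGtail
    rw [← restrict_Ioi_eq_restrict_Ici]
    apply setLIntegral_congr_fun measurableSet_Ioi
    intro s hs
    simp only []
    rw [max_eq_left (le_of_lt hs), LG_int_pow_Ioi s (ht.trans hs) p hp]
    rfl

theorem LG_pow_mul_neg {t : ℝ} (ht : 0 < t) :
    ENNReal.ofReal (t ^ p) * ENNReal.ofReal (t ^ (-p)) = 1 := by
  rw [← ENNReal.ofReal_mul (by positivity), ← Real.rpow_add ht]; simp

theorem LGD_eq_E {t : ℝ} (ht : 0 < t) : LGD p φ t = ENNReal.ofReal (t ^ p) * LGE p φ t := by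
  unfold LGD LGE
  rw [mul_add, ← mul_assoc, LG_pow_mul_neg ht, one_mul]

theorem LGE_eq_D {t : ℝ} (ht : 0 < t) : LGE p φ t = ENNReal.ofReal (t ^ (-p)) * LGD p φ t := by
  rw [LGD_eq_E ht, ← mul_assoc, mul_comm (ENNReal.ofReal (t ^ (-p))), LG_pow_mul_neg ht, one_mul]

theorem LGD_mono (hp : 0 < p) (hφ : Measurable φ) {s t : ℝ} (hs : 0 < s) (hst : s ≤ t) :
    LGD p φ s ≤ LGD p φ t := by
  rw [LGD_eq hp hφ hs, LGD_eq hp hφ (hs.trans_le hst)]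
  exact LG_intPhi_mono _ hst

theorem LGE_anti (hp : 0 < p) (hφ : Measurable φ) {s t : ℝ} (hs : 0 < s) (hst : s ≤ t) :
    LGE p φ t ≤ LGE p φ s := by
  rw [LGE_eq hp hφ hs, LGE_eq hp hφ (hs.trans_le hst)]
  exact LGtail_anti _ hst

theorem LGV_le_D (t : ℝ) : intPhi φ t ≤ LGD p φ t := le_self_add
theorem LGW_le_E (t : ℝ) : LGW p φ t ≤ LGE p φ t := le_add_self
end

/-- standing assumptions on the weight, in the nondegenerate case -/
structure LGok (p : ℝ) (φ : ℝ → ℝ≥0∞) : Prop where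
  hp : 1 < p
  meas : Measurable φ
  Dfin : ∀ t, 0 < t → LGD p φ t ≠ ⊤
  Vpos : ∀ t, 0 < t → intPhi φ t ≠ 0
  W0 : LGW p φ 0 = ⊤

section
variable {p : ℝ} {φ : ℝ → ℝ≥0∞}
theorem LGok.p0 (h : LGok p φ) : 0 < p := by have := h.hp; linarith
theorem LGok.D0 (h : LGok p φ) {t : ℝ} (ht : 0 < t) : LGD p φ t ≠ 0 := fun h0 =>
  h.Vpos t ht (le_antisymm ((LGV_le_D t).trans h0.le) bot_le)
theorem LGok.Efin (h : LGok p φ) {t : ℝ} (ht : 0 < t) : LGE p φ t ≠ ⊤ := by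
  rw [LGE_eq_D ht]; exact ENNReal.mul_ne_top ENNReal.ofReal_ne_top (h.Dfin t ht)
theorem LGok.E0 (h : LGok p φ) {t : ℝ} (ht : 0 < t) : LGE p φ t ≠ 0 := by
  intro h0
  apply h.D0 ht
  rw [LGD_eq_E ht, h0, mul_zero]
theorem LGok.Vfin (h : LGok p φ) {t : ℝ} (ht : 0 < t) : intPhi φ t ≠ ⊤ := ne_top_of_le_ne_top (h.Dfin t ht) (LGV_le_D t)
theorem LGok.Wfin (h : LGok p φ) {t : ℝ} (ht : 0 < t) : LGW p φ t ≠ ⊤ := ne_top_of_le_ne_top (h.Efin ht) (LGW_le_E t)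
end

section
variable {p : ℝ} {φ : ℝ → ℝ≥0∞}

theorem LG_n_eq1 (h : LGok p φ) {r : ℝ} (hr : 0 < r) :
    ENNReal.ofReal p * LGn p φ r = LGd p φ r * intPhi φ r * (LGD p φ r) ^ (-2 : ℝ) := by
  unfold LGn LGd
  rw [ENNReal.ofReal_mul h.p0.le]; ring

theorem LG_n_eq2 (h : LGok p φ) {r : ℝ} (hr : 0 < r) :
    ENNReal.ofReal p * LGn p φ r = LGe p φ r * LGW p φ r * (LGE p φ r) ^ (-2 : ℝ) := by
  unfold LGn LGe
  have e : (LGD p φ r) ^ (-2 : ℝ) = ENNReal.ofReal (r ^ (-2 * p)) * (LGE p φ r) ^ (-2 : ℝ) := by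
    rw [LGD_eq_E hr, ENNReal.mul_rpow_of_ne_top ENNReal.ofReal_ne_top (h.Efin hr),
      ENNReal.ofReal_rpow_of_pos (by positivity), ← Real.rpow_mul hr.le]
    congr 3; ring
  rw [e, ENNReal.ofReal_mul h.p0.le]
  have e2 : ENNReal.ofReal (r ^ (-p - 1)) =
      ENNReal.ofReal (r ^ (p - 1)) * ENNReal.ofReal (r ^ (-2 * p)) := by
    rw [← ENNReal.ofReal_mul (by positivity), ← Real.rpow_add hr]; congr 2; ring
  rw [e2]; ring

theorem LG_one_le_p (h : LGok p φ) : (1 : ℝ≥0∞) ≤ ENNReal.ofReal p := by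
  rw [← ENNReal.ofReal_one]; exact ENNReal.ofReal_le_ofReal h.hp.le

theorem LG_n_le_pn (h : LGok p φ) (r : ℝ) : LGn p φ r ≤ ENNReal.ofReal p * LGn p φ r :=
  le_mul_of_one_le_left bot_le (LG_one_le_p h)

theorem LG_n_le1 (h : LGok p φ) {r : ℝ} (hr : 0 < r) :
    LGn p φ r ≤ LGd p φ r * (LGD p φ r) ^ (-1 : ℝ) := by
  refine (LG_n_le_pn h r).trans ?_
  rw [LG_n_eq1 h hr]
  have : (LGD p φ r) ^ (-1 : ℝ) = LGD p φ r * (LGD p φ r) ^ (-2 : ℝ) := by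
    nth_rw 2 [← ENNReal.rpow_one (LGD p φ r)]
    rw [← ENNReal.rpow_add _ _ (h.D0 hr) (h.Dfin r hr)]; norm_num
  rw [this, mul_assoc]
  gcongr
  exact LGV_le_D r

theorem LG_n_le2 (h : LGok p φ) {r : ℝ} (hr : 0 < r) :
    LGn p φ r ≤ LGe p φ r * (LGE p φ r) ^ (-1 : ℝ) := by
  refine (LG_n_le_pn h r).trans ?_
  rw [LG_n_eq2 h hr]
  have : (LGE p φ r) ^ (-1 : ℝ) = LGE p φ r * (LGE p φ r) ^ (-2 : ℝ) := by
    nth_rw 2 [← ENNReal.rpow_one (LGE p φ r)]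
    rw [← ENNReal.rpow_add _ _ (h.E0 hr) (h.Efin hr)]; norm_num
  rw [this, mul_assoc]
  gcongr
  exact LGW_le_E r

theorem LG_D_tail (h : LGok p φ) (β : ℝ) (hβ : 0 < β) {t : ℝ} (ht : 0 < t) :
    ∫⁻ r in Ioi t, (LGD p φ r) ^ (-β) * LGn p φ r ≤
      ENNReal.ofReal ((1 + β) / β) * (LGD p φ t) ^ (-β) := by
  have e := LGD_eq h.p0 h.meas ht
  have h1 := LG_inc_tail (LGd p φ) LGd_meas β hβ t ht.le (e ▸ h.D0 ht) (e ▸ h.Dfin t ht)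
  rw [← e] at h1
  refine le_trans ?_ h1
  apply setLIntegral_mono' measurableSet_Ioi
  intro r hr
  have hr0 : 0 < r := ht.trans hr
  rw [← LGD_eq h.p0 h.meas hr0]
  calc _ ≤ (LGD p φ r) ^ (-β) * (LGd p φ r * (LGD p φ r) ^ (-1 : ℝ)) := by
        gcongr; exact LG_n_le1 h hr0
    _ = _ := by
        rw [neg_add, ENNReal.rpow_add _ _ (h.D0 hr0) (h.Dfin r hr0)]; ring

theorem LG_E_tail (h : LGok p φ) (β : ℝ) (hβ : 0 < β) {t : ℝ} (ht : 0 < t) :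
    ∫⁻ r in Ioo 0 t, (LGE p φ r) ^ (-β) * LGn p φ r ≤
      ENNReal.ofReal ((1 + β) / β) * (LGE p φ t) ^ (-β) := by
  have e := LGE_eq h.p0 h.meas ht
  have h1 := LG_dec_tail (LGe p φ) LGe_meas β hβ t (e ▸ h.E0 ht) (e ▸ h.Efin ht)
  rw [← e] at h1
  refine le_trans ?_ h1
  refine le_trans ?_ (lintegral_mono_set (s := Ioo 0 t) (fun x hx => hx.2))
  apply setLIntegral_mono' measurableSet_Ioo
  intro r hr
  have hr0 : 0 < r := hr.1
  rw [← LGE_eq h.p0 h.meas hr0]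
  calc _ ≤ (LGE p φ r) ^ (-β) * (LGe p φ r * (LGE p φ r) ^ (-1 : ℝ)) := by
        gcongr; exact LG_n_le2 h hr0
    _ = _ := by
        rw [neg_add, ENNReal.rpow_add _ _ (h.E0 hr0) (h.Efin hr0)]; ring

theorem LG_neg_anti {a b : ℝ≥0∞} (hab : a ≤ b) {α : ℝ} (hα : 0 < α) : b ^ (-α) ≤ a ^ (-α) := by
  rw [ENNReal.rpow_neg, ENNReal.rpow_neg]
  gcongr

theorem LG_V_head (h : LGok p φ) (α : ℝ) (hα : 0 < α) (hα1 : α < 1) {r : ℝ} (hr : 0 < r) :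
    ∫⁻ t in Ioo 0 r, (LGD p φ t) ^ (-α) * φ t ≤
      ENNReal.ofReal (α / (1 - α) + 1) * (LGD p φ r) ^ (1 - α) := by
  calc _ ≤ ∫⁻ t in Ioo 0 r, (intPhi φ t) ^ (-α) * φ t := by
        refine lintegral_mono fun t => mul_le_mul_left ?_ _
        exact LG_neg_anti (LGV_le_D t) hα
    _ ≤ _ := LG_inc_head φ h.meas α hα hα1 r (h.Vfin hr)
    _ ≤ _ := by
        have : 0 ≤ 1 - α := by linarith
        gcongr
        exact LGV_le_D r

theorem LG_W_head (h : LGok p φ) (α : ℝ) (hα : 0 < α) (hα1 : α < 1) {r : ℝ} (hr : 0 < r) :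
    ∫⁻ t in Ioi r, (LGE p φ t) ^ (-α) * LGw p φ t ≤
      ENNReal.ofReal (α / (1 - α) + 1) * (LGE p φ r) ^ (1 - α) := by
  calc _ ≤ ∫⁻ t in Ioi r, (LGW p φ t) ^ (-α) * LGw p φ t := by
        refine lintegral_mono fun t => mul_le_mul_left ?_ _
        exact LG_neg_anti (LGW_le_E t) hα
    _ ≤ _ := LG_dec_head (LGw p φ) (LGw_meas h.meas) α hα hα1 r (h.Wfin hr)
    _ ≤ _ := by
        have : 0 ≤ 1 - α := by linarith
        gcongr
        exact LGW_le_E r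

theorem LG_setwd (n F : ℝ → ℝ≥0∞) (hn : Measurable n) (hF : Measurable F) (S : Set ℝ)
    (hS : MeasurableSet S) :
    ∫⁻ y in S, F y ∂((volume.restrict (Ioi (0:ℝ))).withDensity n) =
      ∫⁻ y in S ∩ Ioi 0, F y * n y := by
  rw [setLIntegral_withDensity_eq_setLIntegral_mul _ hn hF hS, Measure.restrict_restrict hS]
  simp only [Pi.mul_apply, mul_comm (n _)]

theorem LG_wd (n F : ℝ → ℝ≥0∞) (hn : Measurable n) (hF : Measurable F) :
    ∫⁻ y, F y ∂((volume.restrict (Ioi (0:ℝ))).withDensity n) =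
      ∫⁻ y in Ioi 0, F y * n y := by
  have := LG_setwd n F hn hF univ MeasurableSet.univ
  simpa using this

theorem LG_ae_wd (n : ℝ → ℝ≥0∞) (P : ℝ → Prop) (hP : ∀ t, 0 < t → P t) :
    ∀ᵐ t ∂((volume.restrict (Ioi (0:ℝ))).withDensity n), P t := by
  apply (withDensity_absolutelyContinuous _ _).ae_le
  filter_upwards [ae_restrict_mem measurableSet_Ioi] with t ht using hP t ht

theorem LG_meas_sec {Y Z : Type*} [MeasurableSpace Y] [MeasurableSpace Z] (n : Measure Y)
    [SFinite n] (S : Set (Z × Y)) (hS : MeasurableSet S) (F : Y → ℝ≥0∞) (hF : Measurable F) :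
    Measurable fun z => ∫⁻ y in {y | (z, y) ∈ S}, F y ∂n := by
  have hm : Measurable (Function.uncurry fun (z : Z) (y : Y) =>
      S.indicator (fun w : Z × Y => F w.2) (z, y)) := (hF.comp measurable_snd).indicator hS
  convert hm.lintegral_prod_right (ν := n) using 2 with z
  rw [← lintegral_indicator (s := {y | (z, y) ∈ S}) (measurable_prodMk_left hS)]
  rfl

def LGC1 (q : ℝ) : ℝ≥0∞ := ENNReal.ofReal ((1 + 1 / q) / (1 / q))
def LGC2 (q : ℝ) : ℝ≥0∞ := ENNReal.ofReal ((1 - 1 / q) / (1 / q) + 1)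
def LGC (q : ℝ) : ℝ≥0∞ := LGC1 q ^ (q - 1) * LGC2 q
theorem LGC_fin (q : ℝ) (hq : 1 < q) : LGC q ≠ ⊤ :=
  ENNReal.mul_ne_top (ENNReal.rpow_ne_top_of_nonneg (by linarith) ENNReal.ofReal_ne_top)
    ENNReal.ofReal_ne_top

theorem LG_H1 (h : LGok p φ) (q : ℝ) (hq : 1 < q) (U : ℝ → ℝ≥0∞) (hU : Measurable U) :
    ∫⁻ t in Ioi 0, (∫⁻ r in Ioi t, LGD p φ r ^ (-(1 / q)) * U r * LGn p φ r) ^ q * φ t ≤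
      LGC q * ∫⁻ r in Ioi 0, U r ^ q * LGn p φ r := by
  have hq0 : 0 < q := by linarith
  have hq1 : 1 / q < 1 := by rw [div_lt_one hq0]; exact hq
  have hqp : 0 < 1 / q := by positivity
  have hDm := LGD_meas (p := p) (φ := φ)
  have hnm := LGn_meas (p := p) (φ := φ)
  have hφm := h.meas
  have hS : MeasurableSet {q : ℝ × ℝ | q.1 < q.2} := measurableSet_lt measurable_fst measurable_snd
  have key := LG_schur ((volume.restrict (Ioi (0:ℝ))).withDensity (LGn p φ))
    ((volume.restrict (Ioi (0:ℝ))).withDensity φ) {q : ℝ × ℝ | q.1 < q.2} hS q hq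
    (LGD p φ) U (LGD p φ) hDm hU hDm (LGC1 q) (LGC2 q) ?_ ?_
  · rw [LG_wd _ _ hnm (by fun_prop), LG_wd _ _ hφm] at key
    · refine le_trans (le_of_eq ?_) key
      apply setLIntegral_congr_fun measurableSet_Ioi
      intro t ht
      simp only [mem_ofPred_eq]
      rw [LG_setwd _ _ hnm (by fun_prop) _ (by exact measurableSet_Ioi)]
      congr 2
      have : {y | t < y} ∩ Ioi 0 = Ioi t := by
        change Ioi t ∩ Ioi 0 = _
        rw [Ioi_inter_Ioi, max_eq_left (le_of_lt ht)]
      rw [this]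
    · apply Measurable.pow_const
      exact LG_meas_sec _ _ hS _ (by fun_prop)
  · apply LG_ae_wd
    intro t ht
    simp only [mem_ofPred_eq]
    rw [LG_setwd _ _ hnm (by fun_prop) _ (by exact measurableSet_Ioi)]
    have : {y | t < y} ∩ Ioi 0 = Ioi t := by
      change Ioi t ∩ Ioi 0 = _
      rw [Ioi_inter_Ioi, max_eq_left (le_of_lt ht)]
    rw [this]
    exact LG_D_tail h (1 / q) hqp ht
  · apply LG_ae_wd
    intro r hr
    simp only [mem_ofPred_eq]
    rw [LG_setwd _ _ hφm (by fun_prop) _ (by exact measurableSet_Iio)]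
    have : {y | y < r} ∩ Ioi 0 = Ioo 0 r := by
      change Iio r ∩ Ioi 0 = _
      rw [Iio_inter_Ioi]
    rw [this]
    have := LG_V_head h (1 - 1 / q) (by linarith) (by linarith) hr
    rwa [_root_.sub_sub_cancel] at this

theorem LG_H2 (h : LGok p φ) (q : ℝ) (hq : 1 < q) (U : ℝ → ℝ≥0∞) (hU : Measurable U) :
    ∫⁻ t in Ioi 0, (∫⁻ r in Ioo 0 t, LGE p φ r ^ (-(1 / q)) * U r * LGn p φ r) ^ q * LGw p φ t ≤
      LGC q * ∫⁻ r in Ioi 0, U r ^ q * LGn p φ r := by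
  have hq0 : 0 < q := by linarith
  have hq1 : 1 / q < 1 := by rw [div_lt_one hq0]; exact hq
  have hqp : 0 < 1 / q := by positivity
  have hDm := LGE_meas (p := p) (φ := φ)
  have hnm := LGn_meas (p := p) (φ := φ)
  have hφm := LGw_meas (p := p) h.meas
  have hS : MeasurableSet {q : ℝ × ℝ | q.2 < q.1} := measurableSet_lt measurable_snd measurable_fst
  have key := LG_schur ((volume.restrict (Ioi (0:ℝ))).withDensity (LGn p φ))
    ((volume.restrict (Ioi (0:ℝ))).withDensity (LGw p φ)) {q : ℝ × ℝ | q.2 < q.1} hS q hq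
    (LGE p φ) U (LGE p φ) hDm hU hDm (LGC1 q) (LGC2 q) ?_ ?_
  · rw [LG_wd _ _ hnm (by fun_prop), LG_wd _ _ hφm] at key
    · refine le_trans (le_of_eq ?_) key
      apply setLIntegral_congr_fun measurableSet_Ioi
      intro t ht
      simp only [mem_ofPred_eq]
      rw [LG_setwd _ _ hnm (by fun_prop) _ (by exact measurableSet_Iio)]
      congr 2
      have : {y | y < t} ∩ Ioi 0 = Ioo 0 t := by
        change Iio t ∩ Ioi 0 = _
        rw [Iio_inter_Ioi]
      rw [this]
    · apply Measurable.pow_const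
      exact LG_meas_sec _ _ hS _ (by fun_prop)
  · apply LG_ae_wd
    intro t ht
    simp only [mem_ofPred_eq]
    rw [LG_setwd _ _ hnm (by fun_prop) _ (by exact measurableSet_Iio)]
    have : {y | y < t} ∩ Ioi 0 = Ioo 0 t := by
      change Iio t ∩ Ioi 0 = _
      rw [Iio_inter_Ioi]
    rw [this]
    exact LG_E_tail h (1 / q) hqp ht
  · apply LG_ae_wd
    intro r hr
    simp only [mem_ofPred_eq]
    rw [LG_setwd _ _ hφm (by fun_prop) _ (by exact measurableSet_Ioi)]
    have : {y | r < y} ∩ Ioi 0 = Ioi r := by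
      change Ioi r ∩ Ioi 0 = _
      rw [Ioi_inter_Ioi, max_eq_left (le_of_lt hr)]
    rw [this]
    have := LG_W_head h (1 - 1 / q) (by linarith) (by linarith) hr
    rwa [_root_.sub_sub_cancel] at this

/-- the two-sided Hardy operator -/
def LGK (p : ℝ) (φ : ℝ → ℝ≥0∞) (θ : ℝ) (u : ℝ → ℝ≥0∞) (t : ℝ) : ℝ≥0∞ :=
  (∫⁻ r in Ioi t, u r * LGn p φ r) +
    ENNReal.ofReal (t ^ (-θ)) * ∫⁻ r in Ioo 0 t, ENNReal.ofReal (r ^ θ) * u r * LGn p φ r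

theorem LGK_meas (θ : ℝ) (u : ℝ → ℝ≥0∞) : Measurable (LGK p φ θ u) := by
  have h1 : Measurable fun t => ∫⁻ r in Ioi t, u r * LGn p φ r := (LGtail_anti _).measurable
  have h2 : Measurable fun t => ∫⁻ r in Ioo 0 t, ENNReal.ofReal (r ^ θ) * u r * LGn p φ r :=
    (LG_intPhi_mono _).measurable
  unfold LGK
  fun_prop

def LGCK (q : ℝ) : ℝ≥0∞ := 2 ^ (q - 1) * (LGC q + LGC q)
theorem LGCK_fin (q : ℝ) (hq : 1 < q) : LGCK q ≠ ⊤ :=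
  ENNReal.mul_ne_top (ENNReal.rpow_ne_top_of_nonneg (by linarith) (by simp))
    (ENNReal.add_ne_top.2 ⟨LGC_fin q hq, LGC_fin q hq⟩)

theorem LG_H (h : LGok p φ) (q : ℝ) (hq : 1 < q) (u : ℝ → ℝ≥0∞) (hu : Measurable u) :
    ∫⁻ t in Ioi 0, (LGK p φ (p / q) u t) ^ q * φ t ≤
      LGCK q * ∫⁻ r in Ioi 0, u r ^ q * LGD p φ r * LGn p φ r := by
  have hq0 : 0 < q := by linarith
  have hDm := LGD_meas (p := p) (φ := φ)
  have hEm := LGE_meas (p := p) (φ := φ)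
  have hnm := LGn_meas (p := p) (φ := φ)
  have hφm := h.meas
  have hwm := LGw_meas (p := p) h.meas
  have H1 := LG_H1 h q hq (fun r => u r * LGD p φ r ^ (1 / q)) (by fun_prop)
  have H2 := LG_H2 h q hq (fun r => u r * LGD p φ r ^ (1 / q)) (by fun_prop)
  have eU : ∀ r, (u r * LGD p φ r ^ (1 / q)) ^ q = u r ^ q * LGD p φ r := by
    intro r
    rw [ENNReal.mul_rpow_of_nonneg _ _ hq0.le, ← ENNReal.rpow_mul, one_div_mul_cancel hq0.ne',
      ENNReal.rpow_one]
  simp only [eU] at H1 H2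
  have hA : Measurable fun t => ∫⁻ r in Ioi t, u r * LGn p φ r := (LGtail_anti _).measurable
  calc _ ≤ ∫⁻ t in Ioi 0, 2 ^ (q - 1) *
        ((∫⁻ r in Ioi t, LGD p φ r ^ (-(1 / q)) * (u r * LGD p φ r ^ (1 / q)) * LGn p φ r) ^ q * φ t +
        (∫⁻ r in Ioo 0 t, LGE p φ r ^ (-(1 / q)) * (u r * LGD p φ r ^ (1 / q)) * LGn p φ r) ^ q
          * LGw p φ t) := by
        apply setLIntegral_mono' measurableSet_Ioi
        intro t ht
        have ht0 : (0:ℝ) < t := ht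
        have e1 : ∫⁻ r in Ioi t, LGD p φ r ^ (-(1 / q)) * (u r * LGD p φ r ^ (1 / q)) * LGn p φ r =
            ∫⁻ r in Ioi t, u r * LGn p φ r := by
          apply setLIntegral_congr_fun measurableSet_Ioi
          intro r hr
          have hr0 : 0 < r := ht0.trans hr
          have : LGD p φ r ^ (-(1 / q)) * LGD p φ r ^ (1 / q) = 1 := by
            rw [← ENNReal.rpow_add _ _ (h.D0 hr0) (h.Dfin r hr0)]; simp
          calc _ = (LGD p φ r ^ (-(1 / q)) * LGD p φ r ^ (1 / q)) * u r * LGn p φ r := by ring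
            _ = _ := by rw [this, one_mul]
        have e2 : ∫⁻ r in Ioo 0 t, LGE p φ r ^ (-(1 / q)) * (u r * LGD p φ r ^ (1 / q)) * LGn p φ r =
            ∫⁻ r in Ioo 0 t, ENNReal.ofReal (r ^ (p / q)) * u r * LGn p φ r := by
          apply setLIntegral_congr_fun measurableSet_Ioo
          intro r hr
          have hr0 : 0 < r := hr.1
          have : LGE p φ r ^ (-(1 / q)) * LGD p φ r ^ (1 / q) = ENNReal.ofReal (r ^ (p / q)) := by
            rw [LGD_eq_E hr0, ENNReal.mul_rpow_of_nonneg _ _ (by positivity),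
              ENNReal.ofReal_rpow_of_pos (by positivity), ← Real.rpow_mul hr0.le, mul_left_comm,
              ← ENNReal.rpow_add _ _ (h.E0 hr0) (h.Efin hr0)]
            simp [div_eq_mul_inv]
          calc _ = (LGE p φ r ^ (-(1 / q)) * LGD p φ r ^ (1 / q)) * u r * LGn p φ r := by ring
            _ = _ := by rw [this]
        rw [e1, e2]
        calc _ ≤ (2 ^ (q - 1) * ((∫⁻ r in Ioi t, u r * LGn p φ r) ^ q +
              (ENNReal.ofReal (t ^ (-(p / q))) *
                ∫⁻ r in Ioo 0 t, ENNReal.ofReal (r ^ (p / q)) * u r * LGn p φ r) ^ q)) * φ t := by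
              gcongr
              exact ENNReal.rpow_add_le_mul_rpow_add_rpow _ _ hq.le
          _ = _ := by
              have : ENNReal.ofReal (t ^ (-(p / q))) ^ q = ENNReal.ofReal (t ^ (-p)) := by
                rw [ENNReal.ofReal_rpow_of_pos (by positivity), ← Real.rpow_mul ht0.le]
                congr 2; field_simp
              rw [ENNReal.mul_rpow_of_nonneg _ _ hq0.le, this]
              unfold LGw
              ring
    _ ≤ _ := by
        rw [lintegral_const_mul', lintegral_add_left']
        · unfold LGCK
          rw [mul_assoc, add_mul]
          gcongr
        · have : Measurable fun t => ∫⁻ r in Ioi t,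
              LGD p φ r ^ (-(1 / q)) * (u r * LGD p φ r ^ (1 / q)) * LGn p φ r :=
            (LGtail_anti _).measurable
          exact ((this.pow_const q).mul hφm).aemeasurable
        · exact ENNReal.rpow_ne_top_of_nonneg (by linarith) (by simp)
end

section
variable {p : ℝ} {φ : ℝ → ℝ≥0∞}

theorem LG_half {a b c : ℝ≥0∞} (hb : b ≠ ⊤) (h : a = b + c) (h2 : 2 * b ≤ a) : a ≤ 2 * c := by
  have : b ≤ c := by
    rw [h, two_mul] at h2
    exact (ENNReal.add_le_add_iff_left hb).1 h2
  rw [h, two_mul]; gcongr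

theorem LG_core1 (h : LGok p φ) {s t : ℝ} (hs : 0 < s) (hst : s < t)
    (h2 : 2 * LGD p φ s ≤ LGD p φ t) :
    intPhi φ s * (LGD p φ t) ^ (-2 : ℝ) ≤
      2 * ENNReal.ofReal p * ∫⁻ r in Ioo s t, (LGD p φ r)⁻¹ * LGn p φ r := by
  have ht := hs.trans hst
  have e : LGD p φ t = LGD p φ s + ∫⁻ r in Ioo s t, LGd p φ r := by
    rw [LGD_eq h.p0 h.meas hs, LGD_eq h.p0 h.meas ht, restrict_Ioo_eq_restrict_Ico]
    unfold intPhi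
    rw [← lintegral_union measurableSet_Ico, Ioo_union_Ico_eq_Ioo hs hst.le]
    rw [Set.disjoint_left]; intro x hx hx'; exact absurd hx.2 (not_lt.2 hx'.1)
  have e2 := LG_half (h.Dfin s hs) e h2
  have e3 : (LGD p φ t) ^ (-2 : ℝ) = (LGD p φ t) ^ (-2 : ℝ) * (LGD p φ t)⁻¹ * LGD p φ t := by
    rw [mul_assoc, ENNReal.inv_mul_cancel (h.D0 ht) (h.Dfin t ht), mul_one]
  have hm : Measurable fun r => (LGD p φ r)⁻¹ * LGn p φ r := LGD_meas.inv.mul LGn_meas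
  calc _ ≤ intPhi φ s * ((LGD p φ t) ^ (-2 : ℝ) * (LGD p φ t)⁻¹ * (2 * ∫⁻ r in Ioo s t, LGd p φ r)) := by
        refine mul_le_mul_right (e3.le.trans ?_) _; gcongr
    _ = 2 * ∫⁻ r in Ioo s t, (intPhi φ s * ((LGD p φ t) ^ (-2 : ℝ) * (LGD p φ t)⁻¹)) * LGd p φ r := by
        rw [lintegral_const_mul _ LGd_meas]; ring
    _ ≤ 2 * ∫⁻ r in Ioo s t, ENNReal.ofReal p * ((LGD p φ r)⁻¹ * LGn p φ r) := by
        refine mul_le_mul_right ?_ _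
        apply setLIntegral_mono' measurableSet_Ioo
        intro r hr
        have hr0 := hs.trans hr.1
        have hD := LGD_mono h.p0 h.meas hr0 hr.2.le
        rw [mul_left_comm (ENNReal.ofReal p), LG_n_eq1 h hr0]
        calc _ ≤ intPhi φ r * ((LGD p φ r) ^ (-2 : ℝ) * (LGD p φ r)⁻¹) * LGd p φ r := by
              have hx := LG_neg_anti hD (by norm_num : (0:ℝ) < 2)
              have hy := LG_intPhi_mono φ hr.1.le
              exact mul_le_mul_left (mul_le_mul' hy (mul_le_mul' hx (ENNReal.inv_le_inv.2 hD))) _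
          _ = _ := by ring
    _ = _ := by rw [lintegral_const_mul _ hm, mul_assoc]

theorem LG_core2 (h : LGok p φ) {s t : ℝ} (ht : 0 < t) (hst : t < s)
    (h2 : 2 * LGE p φ s ≤ LGE p φ t) :
    LGW p φ s * (LGE p φ t) ^ (-2 : ℝ) ≤
      2 * ENNReal.ofReal p * ∫⁻ r in Ioo t s, (LGE p φ r)⁻¹ * LGn p φ r := by
  have hs := ht.trans hst
  have e : LGE p φ t = LGE p φ s + ∫⁻ r in Ioo t s, LGe p φ r := by
    rw [LGE_eq h.p0 h.meas hs, LGE_eq h.p0 h.meas ht, restrict_Ioo_eq_restrict_Ioc]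
    unfold LGtail
    rw [add_comm, ← lintegral_union measurableSet_Ioi, Ioc_union_Ioi_eq_Ioi hst.le]
    rw [Set.disjoint_left]; intro x hx hx'; exact absurd hx' (not_lt.2 hx.2)
  have e2 := LG_half (h.Efin hs) e h2
  have e3 : (LGE p φ t) ^ (-2 : ℝ) = (LGE p φ t) ^ (-2 : ℝ) * (LGE p φ t)⁻¹ * LGE p φ t := by
    rw [mul_assoc, ENNReal.inv_mul_cancel (h.E0 ht) (h.Efin ht), mul_one]
  have hm : Measurable fun r => (LGE p φ r)⁻¹ * LGn p φ r := LGE_meas.inv.mul LGn_meas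
  calc _ ≤ LGW p φ s * ((LGE p φ t) ^ (-2 : ℝ) * (LGE p φ t)⁻¹ * (2 * ∫⁻ r in Ioo t s, LGe p φ r)) := by
        refine mul_le_mul_right (e3.le.trans ?_) _; gcongr
    _ = 2 * ∫⁻ r in Ioo t s, (LGW p φ s * ((LGE p φ t) ^ (-2 : ℝ) * (LGE p φ t)⁻¹)) * LGe p φ r := by
        rw [lintegral_const_mul _ LGe_meas]; ring
    _ ≤ 2 * ∫⁻ r in Ioo t s, ENNReal.ofReal p * ((LGE p φ r)⁻¹ * LGn p φ r) := by
        refine mul_le_mul_right ?_ _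
        apply setLIntegral_mono' measurableSet_Ioo
        intro r hr
        have hr0 := ht.trans hr.1
        have hD := LGE_anti h.p0 h.meas ht hr.1.le
        rw [mul_left_comm (ENNReal.ofReal p), LG_n_eq2 h hr0]
        calc _ ≤ LGW p φ r * ((LGE p φ r) ^ (-2 : ℝ) * (LGE p φ r)⁻¹) * LGe p φ r := by
              have hx := LG_neg_anti hD (by norm_num : (0:ℝ) < 2)
              have hy : LGW p φ s ≤ LGW p φ r := LGtail_anti _ hr.2.le
              exact mul_le_mul_left (mul_le_mul' hy (mul_le_mul' hx (ENNReal.inv_le_inv.2 hD))) _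
          _ = _ := by ring
    _ = _ := by rw [lintegral_const_mul _ hm, mul_assoc]

theorem LG_D_two (h : LGok p φ) {t : ℝ} (ht : 0 < t) :
    LGD p φ (2 * t) ≤ ENNReal.ofReal (2 ^ p) * LGD p φ t := by
  rw [LGD_eq_E ht, LGD_eq_E (by positivity : 0 < 2 * t), Real.mul_rpow (by norm_num) ht.le,
    ENNReal.ofReal_mul (by positivity), mul_assoc]
  gcongr
  exact LGE_anti h.p0 h.meas ht (by linarith)

theorem LG_E_two (h : LGok p φ) {t : ℝ} (ht : 0 < t) :
    LGE p φ (t / 2) ≤ ENNReal.ofReal (2 ^ p) * LGE p φ t := by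
  have : ENNReal.ofReal ((t / 2) ^ (-p)) = ENNReal.ofReal (2 ^ p) * ENNReal.ofReal (t ^ (-p)) := by
    rw [← ENNReal.ofReal_mul (by positivity), Real.div_rpow ht.le (by norm_num),
      Real.rpow_neg (by norm_num : (0:ℝ) ≤ 2)]
    congr 1; field_simp
  rw [LGE_eq_D ht, LGE_eq_D (by positivity : 0 < t / 2), this, mul_assoc]
  gcongr
  exact LGD_mono h.p0 h.meas (by positivity) (by linarith)

theorem LG_two_lt {a : ℝ≥0∞} (h0 : a ≠ 0) (h1 : a ≠ ⊤) : ¬ 2 * a ≤ a := by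
  rw [not_le, two_mul]
  exact ENNReal.lt_add_right h1 h0

theorem LG_dbl1 (h : LGok p φ) {s : ℝ} (hs : 0 < s) (hex : ∃ t, s < t ∧ 2 * LGD p φ s ≤ LGD p φ t) :
    ∃ t, s < t ∧ 2 * LGD p φ s ≤ LGD p φ t ∧ LGD p φ t ≤ ENNReal.ofReal (2 ^ p) * 2 * LGD p φ s := by
  have hex2 : ∃ n : ℕ, 2 * LGD p φ s ≤ LGD p φ (2 ^ n * s) := by
    obtain ⟨t, hst, ht⟩ := hex
    obtain ⟨n, hn⟩ := pow_unbounded_of_one_lt (t / s) (by norm_num : (1:ℝ) < 2)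
    refine ⟨n, ht.trans (LGD_mono h.p0 h.meas (hs.trans hst) ?_)⟩
    rw [div_lt_iff₀ hs] at hn; exact hn.le
  classical
  have hf := Nat.find_spec hex2
  obtain ⟨m, hm⟩ : ∃ m, Nat.find hex2 = m + 1 := by
    apply Nat.exists_eq_succ_of_ne_zero
    intro h0
    rw [h0, pow_zero, one_mul] at hf
    exact LG_two_lt (h.D0 hs) (h.Dfin s hs) hf
  have hmin : ¬ 2 * LGD p φ s ≤ LGD p φ (2 ^ m * s) := Nat.find_min hex2 (by omega)
  rw [hm] at hf
  refine ⟨2 ^ (m + 1) * s, ?_, hf, ?_⟩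
  · have : (1:ℝ) < 2 ^ (m + 1) := one_lt_pow₀ (by norm_num) (by omega)
    nlinarith
  · rw [pow_succ', mul_assoc]
    refine (LG_D_two h (by positivity)).trans ?_
    rw [mul_assoc]
    gcongr
    exact (not_le.1 hmin).le

theorem LG_tail_sup (h : LGok p φ) {s : ℝ} (hs : 0 < s) (M : ℝ≥0∞) (hM : M ≠ ⊤) :
    ∃ n : ℕ, M ≤ LGW p φ (s / 2 ^ n) := by
  have hlim : Tendsto (fun n : ℕ => s / (2:ℝ) ^ n) atTop (nhds 0) := by
    have := (tendsto_pow_atTop_nhds_zero_of_lt_one (r := (1/2 : ℝ)) (by norm_num) (by norm_num)).const_mul s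
    simpa [div_eq_mul_inv] using this
  have hmono : Monotone fun n : ℕ => Ioi (s / (2:ℝ) ^ n) := by
    intro a b hab
    apply Ioi_subset_Ioi
    gcongr
    norm_num
  have hU : (⋃ n : ℕ, Ioi (s / (2:ℝ) ^ n)) = Ioi 0 := by
    ext x
    simp only [mem_iUnion, mem_Ioi]
    constructor
    · rintro ⟨n, hn⟩
      exact lt_trans (by positivity) hn
    · intro hx
      exact (hlim.eventually (gt_mem_nhds hx)).exists
  have hsup : LGW p φ 0 = ⨆ n : ℕ, LGW p φ (s / 2 ^ n) := by
    rw [LGW, ← LG_tail_eq, ← hU, hmono.measure_iUnion]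
    simp only [LG_tail_eq]; rfl
  rw [h.W0] at hsup
  by_contra hc
  push Not at hc
  have : (⨆ n : ℕ, LGW p φ (s / 2 ^ n)) ≤ M := iSup_le fun n => (hc n).le
  rw [← hsup] at this
  exact hM (top_le_iff.1 this)

theorem LG_dbl2 (h : LGok p φ) {s : ℝ} (hs : 0 < s) :
    ∃ t, 0 < t ∧ t < s ∧ 2 * LGE p φ s ≤ LGE p φ t ∧
      LGE p φ t ≤ ENNReal.ofReal (2 ^ p) * 2 * LGE p φ s := by
  have hex2 : ∃ n : ℕ, 2 * LGE p φ s ≤ LGE p φ (s / 2 ^ n) := by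
    obtain ⟨n, hn⟩ := LG_tail_sup h hs (2 * LGE p φ s) (ENNReal.mul_ne_top (by simp) (h.Efin hs))
    exact ⟨n, hn.trans (LGW_le_E _)⟩
  classical
  have hf := Nat.find_spec hex2
  obtain ⟨m, hm⟩ : ∃ m, Nat.find hex2 = m + 1 := by
    apply Nat.exists_eq_succ_of_ne_zero
    intro h0
    rw [h0, pow_zero, div_one] at hf
    exact LG_two_lt (h.E0 hs) (h.Efin hs) hf
  have hmin : ¬ 2 * LGE p φ s ≤ LGE p φ (s / 2 ^ m) := Nat.find_min hex2 (by omega)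
  rw [hm] at hf
  refine ⟨s / 2 ^ (m + 1), by positivity, ?_, hf, ?_⟩
  · have : (1:ℝ) < 2 ^ (m + 1) := one_lt_pow₀ (by norm_num) (by omega)
    exact div_lt_self hs this
  · rw [pow_succ, ← div_div]
    refine (LG_E_two h (by positivity)).trans ?_
    rw [mul_assoc]
    gcongr
    exact (not_le.1 hmin).le

def LGCL (p : ℝ) : ℝ≥0∞ := 4 * (ENNReal.ofReal (2 ^ p) * 2) ^ 2 * (2 * ENNReal.ofReal p)
theorem LGCL_fin (p : ℝ) : LGCL p ≠ ⊤ := by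
  unfold LGCL
  finiteness

theorem LG_alg {D0 Dt V K : ℝ≥0∞} (hD0 : Dt ≠ 0) (hDt : Dt ≠ ⊤) (h1 : Dt ≤ K * D0)
    (h2 : D0 ≤ 2 * V) : 1 ≤ 4 * K ^ 2 * V * (V * Dt ^ (-2 : ℝ)) := by
  calc (1:ℝ≥0∞) = Dt ^ (2:ℝ) * Dt ^ (-2 : ℝ) := by
        rw [← ENNReal.rpow_add _ _ hD0 hDt]; simp
    _ ≤ (K * (2 * V)) ^ (2:ℝ) * Dt ^ (-2 : ℝ) := by
        gcongr
        exact h1.trans (by gcongr)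
    _ = _ := by
        rw [ENNReal.rpow_two]; ring

theorem LG_Phi_le (M : ℝ≥0∞) (s : ℝ) (hs : ∀ t, s < t → intPhi φ t ≤ M) : ∫⁻ t in Ioi 0, φ t ≤ M := by
  have hmono : Monotone fun n : ℕ => Iio (n : ℝ) := fun a b hab =>
    Iio_subset_Iio (by exact_mod_cast hab)
  have hU : (⋃ n : ℕ, Iio (n : ℝ)) = univ := by
    ext x
    simp only [mem_iUnion, mem_Iio, mem_univ, iff_true]
    exact exists_nat_gt x
  have : ∫⁻ t in Ioi 0, φ t = ((volume.restrict (Ioi (0 : ℝ))).withDensity φ) univ := by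
    rw [withDensity_apply _ MeasurableSet.univ, Measure.restrict_univ]
  rw [this, ← hU, hmono.measure_iUnion]
  apply iSup_le
  intro n
  rw [LG_intPhi_eq]
  exact (LG_intPhi_mono φ (le_max_left (n : ℝ) (s + 1))).trans (hs _ (by simp))

theorem LG_L (h : LGok p φ) (G : ℝ → ℝ≥0∞) (Ginf : ℝ≥0∞)
    (hmono : ∀ r s, 0 < r → r ≤ s → G r ≤ G s)
    (hqc : ∀ r s, 0 < r → r ≤ s → ENNReal.ofReal r * G s ≤ ENNReal.ofReal s * G r)
    (hinf : ∀ s, G s ≤ Ginf) {s : ℝ} (hs : 0 < s) :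
    G s ≤ LGCL p * ∫⁻ t in Ioi 0, φ t * min 1 (ENNReal.ofReal s / ENNReal.ofReal t) *
      (LGK p φ (p - 1) (fun r => G r * (LGD p φ r)⁻¹) t + Ginf / ∫⁻ t in Ioi 0, φ t) := by
  have hDm := LGD_meas (p := p) (φ := φ)
  have hEm := LGE_meas (p := p) (φ := φ)
  have hnm := LGn_meas (p := p) (φ := φ)
  have hφm := h.meas
  set k := LGK p φ (p - 1) (fun r => G r * (LGD p φ r)⁻¹) with hk
  set Φ := ∫⁻ t in Ioi 0, φ t with hΦ
  set J := ∫⁻ t in Ioi 0, φ t * min 1 (ENNReal.ofReal s / ENNReal.ofReal t) * (k t + Ginf / Φ) with hJ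
  by_cases hc : LGD p φ s ≤ 2 * intPhi φ s
  · -- first case
    have hJ1 : ∀ A : ℝ≥0∞, (∀ t, 0 < t → t < s → A ≤ k t + Ginf / Φ) → intPhi φ s * A ≤ J := by
      intro A hA
      unfold intPhi
      rw [← lintegral_mul_const _ hφm]
      calc _ ≤ ∫⁻ t in Ioo 0 s, φ t * min 1 (ENNReal.ofReal s / ENNReal.ofReal t) * (k t + Ginf / Φ) := by
            apply setLIntegral_mono' measurableSet_Ioo
            intro t ht
            have : (1:ℝ≥0∞) ≤ ENNReal.ofReal s / ENNReal.ofReal t := by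
              rw [ENNReal.le_div_iff_mul_le (by simp [ht.1]) (by simp), one_mul]
              exact ENNReal.ofReal_le_ofReal ht.2.le
            rw [min_eq_left this, mul_one]
            gcongr
            exact hA t ht.1 ht.2
        _ ≤ _ := lintegral_mono_set Ioo_subset_Ioi_self
    by_cases hex : ∃ t, s < t ∧ 2 * LGD p φ s ≤ LGD p φ t
    · obtain ⟨t, hst, h2, h3⟩ := LG_dbl1 h hs hex
      have ht := hs.trans hst
      have h4 := LG_alg (h.D0 ht) (h.Dfin t ht) h3 hc
      have h5 := LG_core1 h hs hst h2
      have h6 := hJ1 (G s * ∫⁻ r in Ioo s t, (LGD p φ r)⁻¹ * LGn p φ r) (by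
        intro τ hτ hτs
        refine le_trans ?_ le_self_add
        rw [hk]
        unfold LGK
        refine le_trans ?_ le_self_add
        rw [← lintegral_const_mul _ (by fun_prop)]
        refine le_trans ?_ (lintegral_mono_set (s := Ioo s t) (fun x hx => hτs.trans hx.1))
        apply setLIntegral_mono' measurableSet_Ioo
        intro r hr
        rw [← mul_assoc]
        exact mul_le_mul_left (mul_le_mul_left (hmono s r hs hr.1.le) _) _)
      calc G s = 1 * G s := (one_mul _).symm
        _ ≤ _ := mul_le_mul_left (h4.trans (mul_le_mul_right h5 _)) _
        _ = LGCL p * (intPhi φ s * (G s * ∫⁻ r in Ioo s t, (LGD p φ r)⁻¹ * LGn p φ r)) := by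
            unfold LGCL; ring
        _ ≤ _ := by gcongr
    · push Not at hex
      have hΦ4 : Φ ≤ 4 * intPhi φ s := by
        apply LG_Phi_le _ s
        intro t hst
        calc _ ≤ LGD p φ t := LGV_le_D t
          _ ≤ 2 * LGD p φ s := (hex t hst).le
          _ ≤ 2 * (2 * intPhi φ s) := by gcongr
          _ = _ := by ring
      have hΦ0 : Φ ≠ 0 := by
        intro h0
        apply h.Vpos s hs
        have : intPhi φ s ≤ Φ := lintegral_mono_set Ioo_subset_Ioi_self
        rw [h0] at this
        exact le_antisymm this bot_le
      have hΦt : Φ ≠ ⊤ := ne_top_of_le_ne_top (ENNReal.mul_ne_top (by simp) (h.Vfin hs)) hΦ4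
      have h6 := hJ1 (Ginf / Φ) (fun _ _ _ => le_add_self)
      have h4L : 4 ≤ LGCL p := by
        unfold LGCL
        have h1 := LG_one_le_p h
        have h2 : (1:ℝ≥0∞) ≤ ENNReal.ofReal (2 ^ p) := by
          rw [← ENNReal.ofReal_one]
          exact ENNReal.ofReal_le_ofReal (Real.one_le_rpow (by norm_num) h.p0.le)
        calc (4:ℝ≥0∞) ≤ 4 * (1 * 1) ^ 2 * (1 * 1) := by norm_num
          _ ≤ _ := by gcongr <;> norm_num
      calc G s ≤ Ginf := hinf s
        _ = Φ * (Ginf / Φ) := (ENNReal.mul_div_cancel hΦ0 hΦt).symm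
        _ ≤ 4 * intPhi φ s * (Ginf / Φ) := by gcongr
        _ = 4 * (intPhi φ s * (Ginf / Φ)) := by ring
        _ ≤ _ := by gcongr
  · have hc2 : LGE p φ s ≤ 2 * LGW p φ s := by
      by_contra hc3
      push Not at hc hc3
      have e1 : 2 * (ENNReal.ofReal (s ^ p) * LGW p φ s) < LGD p φ s := by
        rw [LGD_eq_E hs, mul_left_comm]
        exact (ENNReal.mul_lt_mul_iff_right (by simp; positivity) (by simp)).2 hc3
      have := ENNReal.add_lt_add hc e1
      rw [← mul_add, two_mul] at this
      exact lt_irrefl _ this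
    have hJ2 : ∀ A : ℝ≥0∞, (∀ t, s < t → ENNReal.ofReal (t ^ (-(p-1))) * (ENNReal.ofReal s)⁻¹ * A ≤ k t) →
        LGW p φ s * A ≤ J := by
      intro A hA
      unfold LGW LGtail
      rw [← lintegral_mul_const _ (LGw_meas hφm)]
      calc _ ≤ ∫⁻ t in Ioi s, φ t * min 1 (ENNReal.ofReal s / ENNReal.ofReal t) * (k t + Ginf / Φ) := by
            apply setLIntegral_mono' measurableSet_Ioi
            intro t ht
            have ht0 : 0 < t := hs.trans ht
            have : ENNReal.ofReal s / ENNReal.ofReal t ≤ 1 := by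
              apply ENNReal.div_le_of_le_mul
              rw [one_mul]
              exact ENNReal.ofReal_le_ofReal (le_of_lt ht)
            rw [min_eq_right this]
            have e : ENNReal.ofReal (t ^ (-p)) = ENNReal.ofReal s / ENNReal.ofReal t *
                (ENNReal.ofReal (t ^ (-(p-1))) * (ENNReal.ofReal s)⁻¹) := by
              rw [← ENNReal.ofReal_inv_of_pos hs, ← ENNReal.ofReal_div_of_pos ht0,
                ← ENNReal.ofReal_mul (by positivity), ← ENNReal.ofReal_mul (by positivity)]
              congr 1
              rw [show -(p-1) = -p + 1 by ring, Real.rpow_add ht0, Real.rpow_one]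
              field_simp
            unfold LGw
            rw [e, mul_assoc, mul_assoc, mul_assoc (φ t)]
            gcongr
            exact (hA t ht).trans le_self_add
        _ ≤ _ := lintegral_mono_set (Ioi_subset_Ioi hs.le)
    obtain ⟨t, ht, hst, h2, h3⟩ := LG_dbl2 h hs
    have h4 := LG_alg (h.E0 ht) (h.Efin ht) h3 hc2
    have h5 := LG_core2 h ht hst h2
    have h6 := hJ2 (G s * ∫⁻ r in Ioo t s, (LGE p φ r)⁻¹ * LGn p φ r) (by
        intro τ hτs
        rw [hk]
        unfold LGK
        refine le_trans ?_ le_add_self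
        rw [mul_assoc]
        refine mul_le_mul_right ?_ _
        rw [← lintegral_const_mul _ (by fun_prop), ← lintegral_const_mul _ (by fun_prop)]
        refine le_trans ?_ (lintegral_mono_set (s := Ioo t s)
          (fun x hx => ⟨ht.trans hx.1, hx.2.trans hτs⟩))
        apply setLIntegral_mono' measurableSet_Ioo
        intro r hr
        have hr0 := ht.trans hr.1
        rw [← mul_assoc, ← mul_assoc]
        refine mul_le_mul_left ?_ _
        have e : (LGE p φ r)⁻¹ = ENNReal.ofReal (r ^ (p - 1)) * ENNReal.ofReal r * (LGD p φ r)⁻¹ := by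
          rw [LGE_eq_D hr0, ENNReal.mul_inv (Or.inr (h.Dfin r hr0)) (by simp),
            ← ENNReal.ofReal_inv_of_pos (by positivity), ← ENNReal.ofReal_mul (by positivity)]
          congr 2
          rw [Real.rpow_neg hr0.le, inv_inv, Real.rpow_sub_one hr0.ne']
          field_simp
        rw [e]
        calc _ = (ENNReal.ofReal s)⁻¹ * (ENNReal.ofReal r * G s) *
              (ENNReal.ofReal (r ^ (p - 1)) * (LGD p φ r)⁻¹) := by ring
          _ ≤ (ENNReal.ofReal s)⁻¹ * (ENNReal.ofReal s * G r) *
              (ENNReal.ofReal (r ^ (p - 1)) * (LGD p φ r)⁻¹) := by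
              exact mul_le_mul_left (mul_le_mul_right (hqc r s hr0 hr.2.le) _) _
          _ = _ := by
              rw [← mul_assoc (ENNReal.ofReal s)⁻¹, ENNReal.inv_mul_cancel (by simp [hs]) (by simp)]
              ring)
    calc G s = 1 * G s := (one_mul _).symm
        _ ≤ _ := mul_le_mul_left (h4.trans (mul_le_mul_right h5 _)) _
        _ = LGCL p * (LGW p φ s * (G s * ∫⁻ r in Ioo t s, (LGE p φ r)⁻¹ * LGn p φ r)) := by
            unfold LGCL; ring
        _ ≤ _ := by gcongr
end

section
variable {X : Type*} [MeasurableSpace X]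

def LGG (μ : Measure X) (g : X → ℝ≥0∞) (m : ℝ≥0∞) : ℝ≥0∞ :=
  ∫⁻ l in Ioi (0:ℝ), min m (μ {x | ENNReal.ofReal l < g x})

theorem LGdist_anti (μ : Measure X) (g : X → ℝ≥0∞) :
    Antitone fun l : ℝ => μ {x | ENNReal.ofReal l < g x} := fun _ _ hab =>
  measure_mono fun _ hx => lt_of_le_of_lt (ENNReal.ofReal_le_ofReal hab) hx

theorem LGG_mono (μ : Measure X) (g : X → ℝ≥0∞) : Monotone (LGG μ g) := fun _ _ hab =>
  lintegral_mono fun _ => min_le_min_right _ hab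

theorem LGG_mono_g (μ : Measure X) {g g' : X → ℝ≥0∞} (hg : ∀ x, g x ≤ g' x) (m : ℝ≥0∞) :
    LGG μ g m ≤ LGG μ g' m :=
  lintegral_mono fun _ => min_le_min_left _ (measure_mono fun x hx => lt_of_lt_of_le hx (hg x))

theorem LGG_qc (μ : Measure X) (g : X → ℝ≥0∞) {r s : ℝ≥0∞} (hrs : r ≤ s) :
    r * LGG μ g s ≤ s * LGG μ g r := by
  unfold LGG
  have hm := (LGdist_anti μ g).measurable
  rw [← lintegral_const_mul _ (measurable_const.min hm), ← lintegral_const_mul _ (measurable_const.min hm)]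
  apply lintegral_mono
  intro l
  simp only []
  generalize μ {x | ENNReal.ofReal l < g x} = a
  rcases le_total r a with h | h
  · rw [min_eq_left h, mul_comm s]
    gcongr; exact min_le_left _ _
  · rw [min_eq_right h, min_eq_right (h.trans hrs)]
    gcongr

theorem LGG_top (μ : Measure X) [SFinite μ] {g : X → ℝ≥0∞} (hg : Measurable g) :
    LGG μ g ⊤ = ∫⁻ x, g x ∂μ := by
  rw [LG_lcake μ g hg]
  unfold LGG; simp

theorem LGG_le (μ : Measure X) [SFinite μ] {g : X → ℝ≥0∞} (hg : Measurable g) (m : ℝ≥0∞) :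
    LGG μ g m ≤ ∫⁻ x, g x ∂μ := by
  rw [← LGG_top μ hg]; exact LGG_mono _ _ le_top

theorem LGG_zero (μ : Measure X) (g : X → ℝ≥0∞) : LGG μ g 0 = 0 := by
  unfold LGG; simp

theorem LGG_sup (μ : Measure X) (g : X → ℝ≥0∞) : LGG μ g ⊤ = ⨆ n : ℕ, LGG μ g n := by
  unfold LGG
  have hm := (LGdist_anti μ g).measurable
  rw [← lintegral_iSup (f := fun (n : ℕ) l => min (n : ℝ≥0∞) (μ {x | ENNReal.ofReal l < g x}))
    (fun n => measurable_const.min hm)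
    (fun a b hab l => min_le_min_right _ (by exact_mod_cast hab))]
  congr 1
  funext l
  rw [top_inf_eq]
  apply le_antisymm
  · refine le_of_forall_lt fun c hc => ?_
    obtain ⟨n, hn⟩ := ENNReal.exists_nat_gt hc.ne_top
    exact lt_of_lt_of_le (lt_min hn hc)
      (le_iSup (fun n : ℕ => min (n : ℝ≥0∞) (μ {x | ENNReal.ofReal l < g x})) n)
  · exact iSup_le fun n => min_le_right _ _

theorem LG_set_le (μ : Measure X) [SFinite μ] {g : X → ℝ≥0∞} (hg : Measurable g) (A : Set X) :
    ∫⁻ x in A, g x ∂μ ≤ LGG μ g (μ A) := by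
  rw [LG_lcake (μ.restrict A) g hg]
  unfold LGG
  apply lintegral_mono
  intro l
  refine le_min ?_ (Measure.restrict_apply_le _ _)
  exact (measure_mono (subset_univ _)).trans (by simp)

theorem LG_lt_decRearr (μ : Measure X) (f : X → ℝ) (l s : ℝ) (hl : 0 ≤ l) :
    ENNReal.ofReal l < decRearr μ f s ↔
      ENNReal.ofReal s < μ {x | ENNReal.ofReal l < (‖f x‖₊ : ℝ≥0∞)} := by
  constructor
  · intro h
    by_contra hc
    have : decRearr μ f s ≤ ENNReal.ofReal l := sInf_le (not_lt.1 hc)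
    exact absurd this (not_le.2 h)
  · intro h
    have hU : {x | ENNReal.ofReal l < (‖f x‖₊ : ℝ≥0∞)} =
        ⋃ n : ℕ, {x | ENNReal.ofReal (l + 1 / ((n:ℝ) + 1)) < (‖f x‖₊ : ℝ≥0∞)} := by
      ext x
      simp only [mem_ofPred_eq, mem_iUnion]
      rw [← enorm_eq_nnnorm, ← ofReal_norm]
      constructor
      · intro hx
        have hx' := (ENNReal.ofReal_lt_ofReal_iff_of_nonneg hl).1 hx
        obtain ⟨n, hn⟩ := exists_nat_one_div_lt (sub_pos.2 hx')
        refine ⟨n, (ENNReal.ofReal_lt_ofReal_iff_of_nonneg (by positivity)).2 (by linarith)⟩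
      · rintro ⟨n, hn⟩
        refine lt_of_le_of_lt (ENNReal.ofReal_le_ofReal ?_) hn
        have : 0 < 1 / ((n:ℝ) + 1) := by positivity
        linarith
    have hmono : Monotone fun n : ℕ => {x | ENNReal.ofReal (l + 1 / ((n:ℝ) + 1)) < (‖f x‖₊ : ℝ≥0∞)} := by
      intro a b hab x hx
      refine lt_of_le_of_lt (ENNReal.ofReal_le_ofReal ?_) hx
      gcongr
    rw [hU, hmono.measure_iUnion, lt_iSup_iff] at h
    obtain ⟨n, hn⟩ := h
    have h1 : ENNReal.ofReal l < ENNReal.ofReal (l + 1 / ((n:ℝ) + 1)) := by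
      have : 0 < 1 / ((n:ℝ) + 1) := by positivity
      exact (ENNReal.ofReal_lt_ofReal_iff_of_nonneg hl).2 (by linarith)
    refine h1.trans_le (le_sInf ?_)
    intro m hm
    by_contra hc
    push Not at hc
    have : μ {x | ENNReal.ofReal (l + 1 / ((n:ℝ) + 1)) < (‖f x‖₊ : ℝ≥0∞)} ≤ ENNReal.ofReal s :=
      (measure_mono fun x hx => hc.trans hx).trans hm
    exact absurd this (not_le.2 hn)

theorem LG_vol_min (t : ℝ) (ht : 0 ≤ t) (a : ℝ≥0∞) :
    volume ({s : ℝ | ENNReal.ofReal s < a} ∩ Ioo 0 t) = min (ENNReal.ofReal t) a := by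
  rcases le_total (ENNReal.ofReal t) a with h | h
  · have : {s : ℝ | ENNReal.ofReal s < a} ∩ Ioo 0 t = Ioo 0 t := by
      apply inter_eq_right.2
      intro s hs
      refine lt_of_lt_of_le ?_ h
      exact (ENNReal.ofReal_lt_ofReal_iff_of_nonneg hs.1.le).2 hs.2
    rw [this, min_eq_left h]; simp
  · have hat : a ≠ ⊤ := ne_top_of_le_ne_top ENNReal.ofReal_ne_top h
    have : {s : ℝ | ENNReal.ofReal s < a} ∩ Ioo 0 t = Ioo 0 a.toReal := by
      ext s
      simp only [mem_inter_iff, mem_ofPred_eq, mem_Ioo]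
      constructor
      · rintro ⟨h1, h2, h3⟩
        exact ⟨h2, (ENNReal.ofReal_lt_iff_lt_toReal h2.le hat).1 h1⟩
      · rintro ⟨h1, h2⟩
        refine ⟨(ENNReal.ofReal_lt_iff_lt_toReal h1.le hat).2 h2, h1, h2.trans_le ?_⟩
        exact ENNReal.toReal_le_of_le_ofReal ht h
    rw [this, min_eq_right h]; simp [hat]

theorem LG_decRearr_int (μ : Measure X) (f : X → ℝ) (t : ℝ) (ht : 0 ≤ t) :
    ∫⁻ s in Ioo 0 t, decRearr μ f s = LGG μ (fun x => (‖f x‖₊ : ℝ≥0∞)) (ENNReal.ofReal t) := by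
  have hm : Measurable (decRearr μ f) := by
    have : Antitone (decRearr μ f) := by
      intro a b hab
      apply sInf_le_sInf
      intro l hl
      exact le_trans hl (ENNReal.ofReal_le_ofReal hab)
    exact this.measurable
  rw [LG_lcake _ _ hm]
  unfold LGG
  apply setLIntegral_congr_fun measurableSet_Ioi
  intro l hl
  simp only [LG_lt_decRearr μ f l _ (le_of_lt hl)]
  rw [Measure.restrict_apply (measurableSet_lt ENNReal.measurable_ofReal measurable_const),
    LG_vol_min _ ht]

theorem LG_avg_eq (μ : Measure X) (f : X → ℝ) {t : ℝ} (ht : 0 < t) :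
    avgRearr μ f t = (ENNReal.ofReal t)⁻¹ * LGG μ (fun x => (‖f x‖₊ : ℝ≥0∞)) (ENNReal.ofReal t) := by
  unfold avgRearr
  rw [LG_decRearr_int μ f t ht.le]

theorem LG_avg_eq2 (μ : Measure X) (f : X → ℝ) {t : ℝ} (ht : 0 < t) :
    avgRearr μ f t = ∫⁻ l in Ioi (0:ℝ),
      min 1 (μ {x | ENNReal.ofReal l < (‖f x‖₊ : ℝ≥0∞)} / ENNReal.ofReal t) := by
  have hm := (LGdist_anti μ (fun x => (‖f x‖₊ : ℝ≥0∞))).measurable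
  rw [LG_avg_eq μ f ht]
  unfold LGG
  rw [← lintegral_const_mul _ (measurable_const.min hm)]
  congr 1
  funext l
  rw [mul_min, ENNReal.inv_mul_cancel (by simp [ht]) (by simp), mul_comm, div_eq_mul_inv]

section
variable {p : ℝ} {φ : ℝ → ℝ≥0∞}

/-- the dual extremal function -/
def LGKK (μ : Measure X) (p : ℝ) (φ : ℝ → ℝ≥0∞) (g : X → ℝ≥0∞) (t : ℝ) : ℝ≥0∞ :=
  LGK p φ (p - 1) (fun r => LGG μ g (ENNReal.ofReal r) * (LGD p φ r)⁻¹) t +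
    (∫⁻ x, g x ∂μ) / ∫⁻ t in Ioi 0, φ t

theorem LGKK_meas (μ : Measure X) (g : X → ℝ≥0∞) : Measurable (LGKK μ p φ g) :=
  (LGK_meas _ _).add_const _

theorem LG_L2 (μ : Measure X) [SFinite μ] (h : LGok p φ) {g : X → ℝ≥0∞} (hg : Measurable g)
    (d : ℝ≥0∞) :
    LGG μ g d ≤ LGCL p * ∫⁻ t in Ioi 0, φ t * min 1 (d / ENNReal.ofReal t) * LGKK μ p φ g t := by
  have key : ∀ s : ℝ, 0 < s → LGG μ g (ENNReal.ofReal s) ≤ LGCL p *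
      ∫⁻ t in Ioi 0, φ t * min 1 (ENNReal.ofReal s / ENNReal.ofReal t) * LGKK μ p φ g t := by
    intro s hs
    exact LG_L h (fun r => LGG μ g (ENNReal.ofReal r)) (∫⁻ x, g x ∂μ)
      (fun r s _ hrs => LGG_mono _ _ (ENNReal.ofReal_le_ofReal hrs))
      (fun r s _ hrs => LGG_qc _ _ (ENNReal.ofReal_le_ofReal hrs))
      (fun s => LGG_le μ hg _) hs
  have key2 : ∀ d : ℝ≥0∞, d ≠ ⊤ → LGG μ g d ≤ LGCL p *
      ∫⁻ t in Ioi 0, φ t * min 1 (d / ENNReal.ofReal t) * LGKK μ p φ g t := by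
    intro d hd
    rcases eq_or_ne d 0 with rfl | h0
    · rw [LGG_zero]; exact bot_le
    · have := key d.toReal (ENNReal.toReal_pos h0 hd)
      rwa [ENNReal.ofReal_toReal hd] at this
  rcases eq_or_ne d ⊤ with rfl | hd
  · rw [LGG_sup]
    apply iSup_le
    intro n
    refine (key2 n (by simp)).trans ?_
    gcongr
    exact le_top
  · exact key2 d hd

theorem LG_upper1 (μ : Measure X) [SFinite μ] (h : LGok p φ) {g : X → ℝ≥0∞} (hg : Measurable g)
    {f : X → ℝ} (hf : Measurable f) :
    ∫⁻ x, (‖f x‖₊ : ℝ≥0∞) * g x ∂μ ≤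
      LGCL p * ∫⁻ t in Ioi 0, φ t * (avgRearr μ f t * LGKK μ p φ g t) := by
  have hφm := h.meas
  have hKm := LGKK_meas (p := p) (φ := φ) μ g
  have hfm : Measurable fun x => (‖f x‖₊ : ℝ≥0∞) := by fun_prop
  have hm := (LGdist_anti μ (fun x => (‖f x‖₊ : ℝ≥0∞))).measurable
  calc _ = ∫⁻ x, (‖f x‖₊ : ℝ≥0∞) ∂(μ.withDensity g) := by
        rw [lintegral_withDensity_eq_lintegral_mul _ hg hfm]
        simp only [Pi.mul_apply, mul_comm]
    _ = ∫⁻ l in Ioi (0:ℝ), (μ.withDensity g) {x | ENNReal.ofReal l < (‖f x‖₊ : ℝ≥0∞)} :=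
        LG_lcake _ _ hfm
    _ ≤ ∫⁻ l in Ioi (0:ℝ), LGCL p * ∫⁻ t in Ioi 0, φ t *
          min 1 (μ {x | ENNReal.ofReal l < (‖f x‖₊ : ℝ≥0∞)} / ENNReal.ofReal t) * LGKK μ p φ g t := by
        apply lintegral_mono
        intro l
        simp only []
        rw [withDensity_apply _ (measurableSet_lt measurable_const hfm)]
        exact (LG_set_le μ hg _).trans (LG_L2 μ h hg _)
    _ = LGCL p * ∫⁻ l in Ioi (0:ℝ), ∫⁻ t in Ioi 0, φ t *
          min 1 (μ {x | ENNReal.ofReal l < (‖f x‖₊ : ℝ≥0∞)} / ENNReal.ofReal t) * LGKK μ p φ g t := by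
        rw [lintegral_const_mul' _ _ (LGCL_fin p)]
    _ = LGCL p * ∫⁻ t in Ioi 0, ∫⁻ l in Ioi (0:ℝ), φ t *
          min 1 (μ {x | ENNReal.ofReal l < (‖f x‖₊ : ℝ≥0∞)} / ENNReal.ofReal t) * LGKK μ p φ g t := by
        rw [lintegral_lintegral_swap]
        apply Measurable.aemeasurable
        unfold Function.uncurry
        have h1 : Measurable fun a : ℝ × ℝ => μ {x | ENNReal.ofReal a.1 < (‖f x‖₊ : ℝ≥0∞)} :=
          hm.comp measurable_fst
        have h2 : Measurable fun a : ℝ × ℝ => φ a.2 := hφm.comp measurable_snd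
        have h3 : Measurable fun a : ℝ × ℝ => LGKK μ p φ g a.2 := hKm.comp measurable_snd
        exact (h2.mul (measurable_const.min (h1.div (ENNReal.measurable_ofReal.comp measurable_snd)))).mul h3
    _ = _ := by
        congr 1
        apply setLIntegral_congr_fun measurableSet_Ioi
        intro t ht
        simp only []
        have hm2 : Measurable fun l : ℝ => min 1 (μ {x | ENNReal.ofReal l < (‖f x‖₊ : ℝ≥0∞)} /
          ENNReal.ofReal t) := measurable_const.min (hm.div measurable_const)
        rw [LG_avg_eq2 μ f ht, lintegral_mul_const _ (hm2.const_mul _),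
          lintegral_const_mul _ hm2, mul_assoc]

/-- the discretized form of the dual functional to the conjugate power -/
def LGI (μ : Measure X) (p : ℝ) (φ : ℝ → ℝ≥0∞) (g : X → ℝ≥0∞) : ℝ≥0∞ :=
  ∫⁻ r in Ioi 0, (LGG μ g (ENNReal.ofReal r) * (LGD p φ r)⁻¹) ^ (p / (p - 1)) * LGD p φ r * LGn p φ r

theorem LG_avg_meas (μ : Measure X) (f : X → ℝ) : Measurable (avgRearr μ f) := by
  have : Measurable fun t : ℝ => ∫⁻ s in Ioo (0:ℝ) t, decRearr μ f s := (LG_intPhi_mono _).measurable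
  unfold avgRearr
  fun_prop

theorem LG_upper2 (μ : Measure X) [SFinite μ] (h : LGok p φ) {g : X → ℝ≥0∞} (hg : Measurable g)
    {f : X → ℝ} (hf : Measurable f) :
    ∫⁻ x, (‖f x‖₊ : ℝ≥0∞) * g x ∂μ ≤
      LGCL p * ((∫⁻ t in Ioi 0, avgRearr μ f t ^ p * φ t) ^ (1 / p) *
        (LGCK (p / (p - 1)) ^ (1 / (p / (p - 1))) * LGI μ p φ g ^ (1 / (p / (p - 1))) +
          (∫⁻ x, g x ∂μ) / (∫⁻ t in Ioi 0, φ t) ^ (1 / p))) := by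
  have hφm := h.meas
  have hp := h.hp
  have hp0 := h.p0
  have hp1 : 0 < p - 1 := by linarith
  have hKm := LGKK_meas (p := p) (φ := φ) μ g
  have hkm := LGK_meas (p := p) (φ := φ) (p - 1) (fun r => LGG μ g (ENNReal.ofReal r) * (LGD p φ r)⁻¹)
  have ham := LG_avg_meas μ f
  have hDm := LGD_meas (p := p) (φ := φ)
  have hGm : Measurable fun r : ℝ => LGG μ g (ENNReal.ofReal r) :=
    (LGG_mono μ g).measurable.comp ENNReal.measurable_ofReal
  have hconj : p.HolderConjugate (p / (p - 1)) := Real.HolderConjugate.conjExponent hp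
  have hp' : 1 < p / (p - 1) := by rw [lt_div_iff₀ hp1]; linarith
  set p' := p / (p - 1) with hp'd
  refine (LG_upper1 μ h hg hf).trans ?_
  gcongr
  set ν := (volume.restrict (Ioi (0:ℝ))).withDensity φ with hν
  have hcv : ∀ F : ℝ → ℝ≥0∞, Measurable F → ∫⁻ t, F t ∂ν = ∫⁻ t in Ioi 0, F t * φ t := by
    intro F hF
    exact LG_wd φ F hφm hF
  have hold := ENNReal.lintegral_mul_le_Lp_mul_Lq ν hconj ham.aemeasurable hKm.aemeasurable
  simp only [Pi.mul_apply] at hold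
  rw [hcv _ (by fun_prop), hcv _ (by fun_prop)] at hold
  simp only [mul_comm _ (φ _)] at hold ⊢
  refine hold.trans ?_
  gcongr
  have mink := ENNReal.lintegral_Lp_add_le (μ := ν) (p := p') hkm.aemeasurable
    (aemeasurable_const (b := (∫⁻ x, g x ∂μ) / ∫⁻ t in Ioi 0, φ t)) hp'.le
  refine (le_trans (le_of_eq ?_) mink).trans (add_le_add ?_ ?_)
  · rfl
  · rw [hcv _ (by fun_prop), ← ENNReal.mul_rpow_of_nonneg _ _ (by positivity)]
    gcongr
    have := LG_H h p' hp' (fun r => LGG μ g (ENNReal.ofReal r) * (LGD p φ r)⁻¹) (by fun_prop)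
    rwa [show p / p' = p - 1 by rw [hp'd]; field_simp] at this
  · rw [hcv _ (by fun_prop), lintegral_const_mul _ hφm]
    have hinv : 1 / p' = 1 - 1 / p := by rw [hp'd]; field_simp
    set Φ := ∫⁻ t in Ioi 0, φ t
    have hΦ0 : Φ ≠ 0 := by
      intro h0
      apply h.Vpos 1 one_pos
      have : intPhi φ 1 ≤ Φ := lintegral_mono_set Ioo_subset_Ioi_self
      rw [h0] at this
      exact le_antisymm this bot_le
    rw [ENNReal.mul_rpow_of_nonneg _ _ (by positivity), ← ENNReal.rpow_mul,
      mul_one_div_cancel (by positivity), ENNReal.rpow_one]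
    rcases eq_or_ne Φ ⊤ with hΦ | hΦ
    · rw [hΦ]; simp
    · rw [hinv, div_eq_mul_inv, div_eq_mul_inv (∫⁻ x, g x ∂μ), mul_assoc]
      refine mul_le_mul_right (le_of_eq ?_) _
      rw [ENNReal.rpow_sub _ _ hΦ0 hΦ, ENNReal.rpow_one, div_eq_mul_inv, ← mul_assoc,
        ENNReal.inv_mul_cancel hΦ0 hΦ, one_mul]
end
end

section
variable {X : Type*} [MeasurableSpace X]

def LGlam (μ : Measure X) (f : X → ℝ≥0∞) (s : ℝ) : ℝ≥0∞ :=
  sInf {l : ℝ≥0∞ | μ {x | l < f x} ≤ ENNReal.ofReal s}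

theorem LGlam_meas (μ : Measure X) (f : X → ℝ≥0∞) : Measurable (LGlam μ f) := by
  have : Antitone (LGlam μ f) := by
    intro a b hab
    apply sInf_le_sInf
    intro l hl
    exact le_trans hl (ENNReal.ofReal_le_ofReal hab)
  exact this.measurable

theorem LGlam_att (μ : Measure X) (f : X → ℝ≥0∞) (s : ℝ) :
    μ {x | LGlam μ f s < f x} ≤ ENNReal.ofReal s := by
  have hne : {l : ℝ≥0∞ | μ {x | l < f x} ≤ ENNReal.ofReal s}.Nonempty := ⟨⊤, by simp⟩
  obtain ⟨u, hu, hlim, hmem⟩ := exists_seq_tendsto_sInf hne (OrderBot.bddBelow _)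
  have hU : {x | LGlam μ f s < f x} = ⋃ n : ℕ, {x | u n < f x} := by
    ext x
    simp only [mem_ofPred_eq, mem_iUnion]
    constructor
    · intro hx
      exact (hlim.eventually (gt_mem_nhds hx)).exists
    · rintro ⟨n, hn⟩
      exact lt_of_le_of_lt (sInf_le (hmem n)) hn
  have hmono : Monotone fun n : ℕ => {x | u n < f x} := fun a b hab x hx =>
    lt_of_le_of_lt (hu hab) hx
  rw [hU, hmono.measure_iUnion]
  exact iSup_le hmem

theorem LGlam_ge (μ : Measure X) {f : X → ℝ≥0∞} (hf : Measurable f) (hfin : μ {x | f x ≠ 0} ≠ ⊤)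
    (s : ℝ) (h0 : 0 < LGlam μ f s) : ENNReal.ofReal s ≤ μ {x | LGlam μ f s ≤ f x} := by
  obtain ⟨u, hu, hmem, hlim⟩ := exists_seq_strictMono_tendsto' h0
  have hU : {x | LGlam μ f s ≤ f x} = ⋂ n : ℕ, {x | u n < f x} := by
    ext x
    simp only [mem_ofPred_eq, mem_iInter]
    constructor
    · intro hx n
      exact lt_of_lt_of_le (hmem n).2 hx
    · intro hx
      exact le_of_tendsto' hlim fun n => (hx n).le
  have hanti : Antitone fun n : ℕ => {x | u n < f x} := fun a b hab x hx =>
    lt_of_le_of_lt (hu.monotone hab) hx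
  rw [hU, hanti.measure_iInter (fun n => (measurableSet_lt measurable_const hf).nullMeasurableSet)
    ⟨0, ne_top_of_le_ne_top hfin (measure_mono fun x hx => (lt_of_le_of_lt bot_le hx).ne')⟩]
  apply le_iInf
  intro n
  by_contra hc
  exact absurd (hmem n).2 (not_lt.2 (sInf_le (not_le.1 hc).le))

def LGtheta (μ : Measure X) (f : X → ℝ≥0∞) (s : ℝ) : ℝ≥0∞ :=
  min 1 ((ENNReal.ofReal s - μ {x | LGlam μ f s < f x}) / μ {x | f x = LGlam μ f s})

def LGkap (μ : Measure X) (f : X → ℝ≥0∞) (s : ℝ) (x : X) : ℝ≥0∞ :=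
  {x | LGlam μ f s < f x}.indicator (fun _ => 1) x +
    {x | f x = LGlam μ f s}.indicator (fun _ => LGtheta μ f s) x

theorem LGtheta_meas (μ : Measure X) [SFinite μ] {f : X → ℝ≥0∞} (hf : Measurable f) :
    Measurable (LGtheta μ f) := by
  have hl := LGlam_meas μ f
  have h1 : MeasurableSet {q : ℝ × X | LGlam μ f q.1 < f q.2} :=
    measurableSet_lt (hl.comp measurable_fst) (hf.comp measurable_snd)
  have h2 : MeasurableSet {q : ℝ × X | f q.2 = LGlam μ f q.1} :=
    measurableSet_eq_fun (hf.comp measurable_snd) (hl.comp measurable_fst)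
  have h3 := measurable_measure_prodMk_left (ν := μ) h1
  have h4 := measurable_measure_prodMk_left (ν := μ) h2
  exact measurable_const.min ((ENNReal.measurable_ofReal.sub h3).div h4)

theorem LGkap_meas (μ : Measure X) [SFinite μ] {f : X → ℝ≥0∞} (hf : Measurable f) :
    Measurable fun q : ℝ × X => LGkap μ f q.1 q.2 := by
  have hl := LGlam_meas μ f
  have h1 : MeasurableSet {q : ℝ × X | LGlam μ f q.1 < f q.2} :=
    measurableSet_lt (hl.comp measurable_fst) (hf.comp measurable_snd)
  have h2 : MeasurableSet {q : ℝ × X | f q.2 = LGlam μ f q.1} :=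
    measurableSet_eq_fun (hf.comp measurable_snd) (hl.comp measurable_fst)
  exact (Measurable.indicator (measurable_const (a := (1:ℝ≥0∞))) h1).add
    (Measurable.indicator ((LGtheta_meas μ hf).comp measurable_fst) h2)

theorem LGkap_le (μ : Measure X) (f : X → ℝ≥0∞) (s : ℝ) (x : X) : LGkap μ f s x ≤ 1 := by
  unfold LGkap
  by_cases h : f x = LGlam μ f s
  · have h' : x ∉ {x | LGlam μ f s < f x} := by simp [h]
    rw [indicator_of_notMem h', zero_add, indicator_of_mem (by exact h)]
    exact min_le_left _ _
  · rw [indicator_of_notMem (s := {x | f x = LGlam μ f s}) (by exact h), add_zero]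
    exact indicator_le_self _ _ _ 

theorem LGkap_set (μ : Measure X) {f : X → ℝ≥0∞} (hf : Measurable f) (s : ℝ) (A : Set X) 
    (hA : {x | LGlam μ f s ≤ f x} ⊆ A) :
    ∫⁻ x in A, LGkap μ f s x ∂μ =
      μ {x | LGlam μ f s < f x} + LGtheta μ f s * μ {x | f x = LGlam μ f s} := by
  have h1 : MeasurableSet {x | LGlam μ f s < f x} := measurableSet_lt measurable_const hf
  have h2 : MeasurableSet {x | f x = LGlam μ f s} := measurableSet_eq_fun hf measurable_const
  unfold LGkap
  rw [lintegral_add_left (measurable_const.indicator h1), lintegral_indicator h1,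
    lintegral_indicator h2]
  simp only [lintegral_const, one_mul, Measure.restrict_apply MeasurableSet.univ, univ_inter]
  rw [Measure.restrict_apply h1, Measure.restrict_apply h2, inter_eq_left.2, inter_eq_left.2]
  · intro x hx; exact hA (show LGlam μ f s ≤ f x from le_of_eq (Eq.symm hx))
  · intro x hx; exact hA (show LGlam μ f s ≤ f x from le_of_lt hx)

theorem LGkap_int (μ : Measure X) {f : X → ℝ≥0∞} (hf : Measurable f) (s : ℝ) :
    ∫⁻ x, LGkap μ f s x ∂μ ≤ ENNReal.ofReal s := by
  have := LGkap_set μ hf s univ (subset_univ _)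
  rw [Measure.restrict_univ] at this
  rw [this]
  calc _ ≤ μ {x | LGlam μ f s < f x} + (ENNReal.ofReal s - μ {x | LGlam μ f s < f x}) := by
        gcongr
        unfold LGtheta
        refine le_trans (mul_le_mul_left (min_le_right _ _) _) ?_
        exact ENNReal.mul_le_of_le_div le_rfl
    _ = _ := add_tsub_cancel_of_le (LGlam_att μ f s)

theorem LGkap_ge (μ : Measure X) [SFinite μ] {f : X → ℝ≥0∞} (hf : Measurable f)
    (hfin : μ {x | f x ≠ 0} ≠ ⊤) (s : ℝ) :
    LGG μ f (ENNReal.ofReal s) ≤ ∫⁻ x, LGkap μ f s x * f x ∂μ := by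
  have hkm : Measurable fun x => LGkap μ f s x :=
    Measurable.comp (g := fun q : ℝ × X => LGkap μ f q.1 q.2) (f := fun x => (s, x))
      (LGkap_meas μ hf) measurable_prodMk_left
  have e : ∫⁻ x, LGkap μ f s x * f x ∂μ = ∫⁻ x, f x ∂(μ.withDensity (LGkap μ f s)) := by
    rw [lintegral_withDensity_eq_lintegral_mul _ hkm hf]; rfl
  rw [e, LG_lcake _ _ hf]
  unfold LGG
  apply lintegral_mono
  intro l
  simp only []
  have hml : MeasurableSet {x | ENNReal.ofReal l < f x} := measurableSet_lt measurable_const hf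
  rw [withDensity_apply _ hml]
  rcases le_or_gt (LGlam μ f s) (ENNReal.ofReal l) with hl | hl
  · refine (min_le_right _ _).trans ?_
    rw [← setLIntegral_one]
    apply setLIntegral_mono' hml
    intro x hx
    unfold LGkap
    rw [indicator_of_mem (by exact lt_of_le_of_lt hl hx)]
    exact le_self_add
  · refine (min_le_left _ _).trans ?_
    rw [LGkap_set μ hf s {x | ENNReal.ofReal l < f x} (fun x hx => show ENNReal.ofReal l < f x from lt_of_lt_of_le hl hx)]
    have h0 : 0 < LGlam μ f s := lt_of_le_of_lt bot_le hl
    have h1 := LGlam_ge μ hf hfin s h0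
    have h2 := LGlam_att μ f s
    have hafin : μ {x | f x = LGlam μ f s} ≠ ⊤ :=
      ne_top_of_le_ne_top hfin (measure_mono fun x hx => by
        have : f x = LGlam μ f s := hx
        simp only [mem_ofPred_eq, this]; exact h0.ne')
    have hun : μ {x | LGlam μ f s ≤ f x} ≤ μ {x | LGlam μ f s < f x} + μ {x | f x = LGlam μ f s} := by
      refine le_trans (measure_mono ?_) (measure_union_le _ _)
      intro x hx
      rcases lt_or_eq_of_le (show LGlam μ f s ≤ f x from hx) with h | h
      · exact Or.inl h
      · exact Or.inr h.symm
    unfold LGtheta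
    set m := μ {x | LGlam μ f s < f x}
    set a := μ {x | f x = LGlam μ f s}
    rcases min_cases (1:ℝ≥0∞) ((ENNReal.ofReal s - m) / a) with ⟨h, _⟩ | ⟨h, _⟩
    · rw [h, one_mul]; exact h1.trans hun
    · rw [h]
      rcases eq_or_ne a 0 with ha | ha
      · rw [ha, add_zero] at hun
        exact (h1.trans hun).trans le_self_add
      · rw [ENNReal.div_mul_cancel ha hafin]
        exact le_add_tsub

section
variable {p : ℝ} {φ : ℝ → ℝ≥0∞}

theorem LG_I_fin (μ : Measure X) [SFinite μ] (h : LGok p φ) {g : X → ℝ≥0∞} (hg : Measurable g)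
    (N : ℕ) (hN : ∀ x, g x ≤ N) (hint : ∫⁻ x, g x ∂μ ≠ ⊤) : LGI μ p φ g ≠ ⊤ := by
  have hp := h.hp
  have hp1 : 0 < p - 1 := by linarith
  have hp' : 1 < p / (p - 1) := by rw [lt_div_iff₀ hp1]; linarith
  have hGN : ∀ m, LGG μ g m ≤ m * N := by
    intro m
    calc LGG μ g m ≤ ∫⁻ l in Ioi (0:ℝ), (Ioo (0:ℝ) N).indicator (fun _ => m) l := by
          unfold LGG
          apply setLIntegral_mono' measurableSet_Ioi
          intro l hl
          by_cases hlN : l < N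
          · rw [indicator_of_mem (by exact ⟨hl, hlN⟩)]; exact min_le_left _ _
          · rw [indicator_of_notMem (fun hx => hlN hx.2)]
            refine (min_le_right _ _).trans (le_of_eq ?_)
            have : {x | ENNReal.ofReal l < g x} = ∅ := by
              ext x
              simp only [mem_ofPred_eq, mem_empty_iff_false, iff_false, not_lt]
              refine (hN x).trans ?_
              rw [← ENNReal.ofReal_natCast]
              exact ENNReal.ofReal_le_ofReal (not_lt.1 hlN)
            rw [this, measure_empty]
      _ = m * N := by
          rw [lintegral_indicator measurableSet_Ioo, lintegral_const,
            Measure.restrict_apply MeasurableSet.univ, univ_inter,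
            Measure.restrict_apply measurableSet_Ioo, inter_eq_left.2 Ioo_subset_Ioi_self]
          simp
  set p' := p / (p - 1) with hp'd
  have hβ : 0 < p' - 1 := by linarith
  have hp'0 : 0 ≤ p' := by linarith
  have hDm := LGD_meas (p := p) (φ := φ)
  have hEm := LGE_meas (p := p) (φ := φ)
  have hnm := LGn_meas (p := p) (φ := φ)
  have eD : ∀ r, 0 < r → ((LGD p φ r)⁻¹) ^ p' * LGD p φ r = LGD p φ r ^ (-(p' - 1)) := by
    intro r hr
    rw [← ENNReal.rpow_neg_one, ← ENNReal.rpow_mul]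
    nth_rw 2 [← ENNReal.rpow_one (LGD p φ r)]
    rw [← ENNReal.rpow_add _ _ (h.D0 hr) (h.Dfin r hr)]
    congr 1; ring
  unfold LGI
  rw [← Ioc_union_Ioi_eq_Ioi (zero_le_one' ℝ), lintegral_union measurableSet_Ioi
    (by rw [Set.disjoint_left]; intro x hx hx'; exact absurd hx' (not_lt.2 hx.2)),
    ← restrict_Ioo_eq_restrict_Ioc]
  apply ENNReal.add_ne_top.2
  constructor
  · apply ne_top_of_le_ne_top _ (calc
      _ ≤ ∫⁻ r in Ioo (0:ℝ) 1, (N : ℝ≥0∞) ^ p' * (LGE p φ r ^ (-(p' - 1)) * LGn p φ r) := by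
          apply setLIntegral_mono' measurableSet_Ioo
          intro r hr
          have hr0 := hr.1
          calc _ ≤ (ENNReal.ofReal r * N * (LGD p φ r)⁻¹) ^ p' * LGD p φ r * LGn p φ r := by
                gcongr; exact hGN _
            _ = (N : ℝ≥0∞) ^ p' * (ENNReal.ofReal r ^ p' *
                (((LGD p φ r)⁻¹) ^ p' * LGD p φ r) * LGn p φ r) := by
                rw [ENNReal.mul_rpow_of_nonneg _ _ hp'0, ENNReal.mul_rpow_of_nonneg _ _ hp'0]; ring
            _ = _ := by
                rw [eD r hr0]
                congr 2
                rw [LGD_eq_E hr0, ENNReal.mul_rpow_of_ne_top ENNReal.ofReal_ne_top (h.Efin hr0),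
                  ← mul_assoc, ENNReal.ofReal_rpow_of_pos hr0,
                  ENNReal.ofReal_rpow_of_pos (by positivity), ← ENNReal.ofReal_mul (by positivity),
                  ← Real.rpow_mul hr0.le, ← Real.rpow_add hr0]
                have : p' + p * -(p' - 1) = 0 := by rw [hp'd]; field_simp; ring
                rw [this]; simp
      _ = (N : ℝ≥0∞) ^ p' * ∫⁻ r in Ioo (0:ℝ) 1, (LGE p φ r ^ (-(p' - 1)) * LGn p φ r) := by
          rw [lintegral_const_mul _ (by fun_prop)]
      _ ≤ (N : ℝ≥0∞) ^ p' * _ := mul_le_mul_right (LG_E_tail h (p' - 1) hβ one_pos) _)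
    refine ENNReal.mul_ne_top (ENNReal.rpow_ne_top_of_nonneg hp'0 (by simp))
      (ENNReal.mul_ne_top (by simp) ?_)
    exact ENNReal.rpow_ne_top_of_ne_zero (h.E0 one_pos) (h.Efin one_pos)
  · apply ne_top_of_le_ne_top _ (calc
      _ ≤ ∫⁻ r in Ioi (1:ℝ), (∫⁻ x, g x ∂μ) ^ p' * (LGD p φ r ^ (-(p' - 1)) * LGn p φ r) := by
          apply setLIntegral_mono' measurableSet_Ioi
          intro r hr
          have hr0 : 0 < r := lt_trans one_pos hr
          calc _ ≤ ((∫⁻ x, g x ∂μ) * (LGD p φ r)⁻¹) ^ p' * LGD p φ r * LGn p φ r := by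
                gcongr; exact LGG_le μ hg _
            _ = (∫⁻ x, g x ∂μ) ^ p' * ((((LGD p φ r)⁻¹) ^ p' * LGD p φ r) * LGn p φ r) := by
                rw [ENNReal.mul_rpow_of_nonneg _ _ hp'0]; ring
            _ = _ := by rw [eD r hr0]
      _ = (∫⁻ x, g x ∂μ) ^ p' * ∫⁻ r in Ioi (1:ℝ), (LGD p φ r ^ (-(p' - 1)) * LGn p φ r) := by
          rw [lintegral_const_mul _ (by fun_prop)]
      _ ≤ (∫⁻ x, g x ∂μ) ^ p' * _ := mul_le_mul_right (LG_D_tail h (p' - 1) hβ one_pos) _)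
    refine ENNReal.mul_ne_top (ENNReal.rpow_ne_top_of_nonneg hp'0 hint)
      (ENNReal.mul_ne_top (by simp) ?_)
    exact ENNReal.rpow_ne_top_of_ne_zero (h.D0 one_pos) (h.Dfin 1 one_pos)
end
end

section
variable {X : Type*} [MeasurableSpace X]

theorem LGkap_slice (μ : Measure X) [SFinite μ] {f : X → ℝ≥0∞} (hf : Measurable f) (s : ℝ) :
    Measurable fun x => LGkap μ f s x :=
  Measurable.comp (g := fun q : ℝ × X => LGkap μ f q.1 q.2) (f := fun x => (s, x))
      (LGkap_meas μ hf) measurable_prodMk_left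

def LGF (μ : Measure X) (g : X → ℝ≥0∞) (m : ℝ → ℝ≥0∞) (x : X) : ℝ≥0∞ :=
  {x | g x ≠ 0}.indicator (fun x => ∫⁻ s in Ioi (0:ℝ), LGkap μ g s x * m s) x

theorem LGF_joint (μ : Measure X) [SFinite μ] {g : X → ℝ≥0∞} (hg : Measurable g)
    {m : ℝ → ℝ≥0∞} (hm : Measurable m) :
    Measurable fun q : ℝ × X => LGkap μ g q.1 q.2 * m q.1 :=
  (LGkap_meas μ hg).mul (hm.comp measurable_fst)

theorem LGF_int_meas (μ : Measure X) [SFinite μ] {g : X → ℝ≥0∞} (hg : Measurable g)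
    {m : ℝ → ℝ≥0∞} (hm : Measurable m) :
    Measurable fun x => ∫⁻ s in Ioi (0:ℝ), LGkap μ g s x * m s :=
  Measurable.lintegral_prod_left' (μ := volume.restrict (Ioi (0:ℝ))) (LGF_joint μ hg hm)

theorem LGF_meas (μ : Measure X) [SFinite μ] {g : X → ℝ≥0∞} (hg : Measurable g)
    {m : ℝ → ℝ≥0∞} (hm : Measurable m) : Measurable (LGF μ g m) :=
  (LGF_int_meas μ hg hm).indicator (measurableSet_eq_fun hg measurable_const).compl

theorem LGF_swap (μ : Measure X) [SFinite μ] {g : X → ℝ≥0∞} (hg : Measurable g)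
    {m : ℝ → ℝ≥0∞} (hm : Measurable m) {w : X → ℝ≥0∞} (hw : Measurable w) :
    ∫⁻ x, (∫⁻ s in Ioi (0:ℝ), LGkap μ g s x * m s) * w x ∂μ =
      ∫⁻ s in Ioi (0:ℝ), m s * ∫⁻ x, LGkap μ g s x * w x ∂μ := by
  have hj := LGF_joint μ hg hm
  have h1 : ∀ x, (∫⁻ s in Ioi (0:ℝ), LGkap μ g s x * m s) * w x =
      ∫⁻ s in Ioi (0:ℝ), LGkap μ g s x * m s * w x := by
    intro x
    rw [lintegral_mul_const]
    exact Measurable.comp (g := fun q : ℝ × X => LGkap μ g q.1 q.2 * m q.1)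
      (f := fun s => (s, x)) hj measurable_prodMk_right
  simp_rw [h1]
  rw [lintegral_lintegral_swap]
  · congr 1
    funext s
    rw [← lintegral_const_mul]
    · congr 1; funext x; ring
    · exact (LGkap_slice μ hg s).mul hw
  · exact (Measurable.comp (g := fun q : ℝ × X => LGkap μ g q.1 q.2 * m q.1 * w q.2)
      (f := Prod.swap) (hj.mul (hw.comp measurable_snd)) measurable_swap).aemeasurable

theorem LGF_G (μ : Measure X) [SFinite μ] {g : X → ℝ≥0∞} (hg : Measurable g)
    (hfin : μ {x | g x ≠ 0} ≠ ⊤) {m : ℝ → ℝ≥0∞} (hm : Measurable m) (t : ℝ) :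
    LGG μ (LGF μ g m) (ENNReal.ofReal t) ≤
      ∫⁻ s in Ioi (0:ℝ), m s * min (ENNReal.ofReal s) (ENNReal.ofReal t) := by
  have hF := LGF_meas μ hg hm
  have hFfin : μ {x | LGF μ g m x ≠ 0} ≠ ⊤ := by
    apply ne_top_of_le_ne_top hfin
    apply measure_mono
    intro x hx
    by_contra hc
    exact hx (indicator_of_notMem hc _)
  refine (LGkap_ge μ hF hFfin t).trans ?_
  calc _ ≤ ∫⁻ x, (∫⁻ s in Ioi (0:ℝ), LGkap μ g s x * m s) * LGkap μ (LGF μ g m) t x ∂μ := by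
        apply lintegral_mono
        intro x
        simp only []
        rw [mul_comm]
        exact mul_le_mul_left (indicator_le_self _ _ _) _
    _ = _ := LGF_swap μ hg hm (LGkap_slice μ hF t)
    _ ≤ _ := by
        apply lintegral_mono
        intro s
        simp only []
        refine mul_le_mul_right (le_min ?_ ?_) _
        · refine le_trans (lintegral_mono fun x => ?_) (LGkap_int μ hg s)
          exact mul_le_of_le_one_right' (LGkap_le _ _ _ _)
        · refine le_trans (lintegral_mono fun x => ?_) (LGkap_int μ hF t)
          exact mul_le_of_le_one_left' (LGkap_le _ _ _ _)

theorem LGF_ge (μ : Measure X) [SFinite μ] {g : X → ℝ≥0∞} (hg : Measurable g)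
    (hfin : μ {x | g x ≠ 0} ≠ ⊤) {m : ℝ → ℝ≥0∞} (hm : Measurable m) :
    ∫⁻ s in Ioi (0:ℝ), m s * LGG μ g (ENNReal.ofReal s) ≤ ∫⁻ x, LGF μ g m x * g x ∂μ := by
  have : ∀ x, LGF μ g m x * g x = (∫⁻ s in Ioi (0:ℝ), LGkap μ g s x * m s) * g x := by
    intro x
    unfold LGF
    by_cases hx : g x = 0
    · rw [hx]; simp
    · rw [indicator_of_mem (by exact hx)]
  simp_rw [this]
  rw [LGF_swap μ hg hm hg]
  apply lintegral_mono
  intro s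
  exact mul_le_mul_right (LGkap_ge μ hg hfin s) _

section
variable {p : ℝ} {φ : ℝ → ℝ≥0∞}

theorem LG_K_eq (v : ℝ → ℝ≥0∞) {t : ℝ} (ht : 0 < t) :
    (ENNReal.ofReal t)⁻¹ * ∫⁻ s in Ioi (0:ℝ), (v s * LGn p φ s) * min (ENNReal.ofReal s) (ENNReal.ofReal t)
      ≤ LGK p φ 1 v t := by
  have ht0 : ENNReal.ofReal t ≠ 0 := by simp [ht]
  unfold LGK
  rw [← Ioc_union_Ioi_eq_Ioi ht.le, lintegral_union measurableSet_Ioi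
    (by rw [Set.disjoint_left]; intro x hx hx'; exact absurd hx' (not_lt.2 hx.2)),
    ← restrict_Ioo_eq_restrict_Ioc, mul_add, add_comm]
  refine add_le_add ?_ ?_
  · rw [← lintegral_const_mul' _ _ (by simp [ht])]
    apply lintegral_mono
    intro s
    simp only []
    calc _ ≤ (ENNReal.ofReal t)⁻¹ * (v s * LGn p φ s * ENNReal.ofReal t) :=
          mul_le_mul_right (mul_le_mul_right (min_le_right _ _) _) _
      _ = ((ENNReal.ofReal t)⁻¹ * ENNReal.ofReal t) * (v s * LGn p φ s) := by ring
      _ = _ := by rw [ENNReal.inv_mul_cancel ht0 (by simp), one_mul]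
  · rw [Real.rpow_neg_one, ENNReal.ofReal_inv_of_pos ht]
    refine mul_le_mul_right (lintegral_mono fun s => ?_) _
    simp only [Real.rpow_one]
    calc _ ≤ v s * LGn p φ s * ENNReal.ofReal s := mul_le_mul_right (min_le_left _ _) _
      _ = _ := by ring

theorem LG_lower1 (μ : Measure X) [SFinite μ] (h : LGok p φ) {g : X → ℝ≥0∞} (hg : Measurable g)
    (hfin : μ {x | g x ≠ 0} ≠ ⊤) (hI : LGI μ p φ g ≠ ⊤) (B : ℝ≥0∞)
    (hB : ∀ f : X → ℝ, Measurable f → ∫⁻ t in Ioi 0, avgRearr μ f t ^ p * φ t ≤ 1 →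
      ∫⁻ x, (‖f x‖₊ : ℝ≥0∞) * g x ∂μ ≤ B) :
    LGI μ p φ g ^ (1 / (p / (p - 1))) ≤ (LGCK p + 1) ^ (1 / p) * B := by
  have hp := h.hp
  have hp0 := h.p0
  have hp1 : 0 < p - 1 := by linarith
  have hCK := LGCK_fin p hp
  have hDm := LGD_meas (p := p) (φ := φ)
  have hnm := LGn_meas (p := p) (φ := φ)
  set I := LGI μ p φ g with hId
  rcases eq_or_ne I 0 with hI0 | hI0
  · rw [hI0, ENNReal.zero_rpow_of_pos (by positivity)]; exact bot_le
  set c := (LGCK p + 1) * I with hc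
  have hc0 : c ≠ 0 := mul_ne_zero (by simp) hI0
  have hct : c ≠ ⊤ := ENNReal.mul_ne_top (by simp [hCK]) hI
  set a := c ^ (-(1 / p)) with ha
  have hat : a ≠ ⊤ := ENNReal.rpow_ne_top_of_ne_zero hc0 hct
  have hap : a ^ p = c⁻¹ := by
    rw [ha, ← ENNReal.rpow_mul]
    rw [show -(1/p) * p = -1 by field_simp, ENNReal.rpow_neg_one]
  set u : ℝ → ℝ≥0∞ := fun r => LGG μ g (ENNReal.ofReal r) * (LGD p φ r)⁻¹ with hu
  have hum : Measurable u :=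
    ((LGG_mono μ g).measurable.comp ENNReal.measurable_ofReal).mul hDm.inv
  set v : ℝ → ℝ≥0∞ := fun r => a * u r ^ (1 / (p - 1)) with hv
  have hvm : Measurable v := measurable_const.mul (hum.pow_const _)
  have hmm : Measurable fun r => v r * LGn p φ r := hvm.mul hnm
  set F := LGF μ g (fun r => v r * LGn p φ r) with hF
  have hFm : Measurable F := LGF_meas μ hg hmm
  -- pairing
  have hpair : a * I ≤ ∫⁻ x, F x * g x ∂μ := by
    refine le_trans (le_of_eq ?_) (LGF_ge μ hg hfin hmm)
    rw [hId]
    unfold LGI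
    rw [← lintegral_const_mul' _ _ hat]
    apply setLIntegral_congr_fun measurableSet_Ioi
    intro r hr
    simp only []
    have e1 : u r ^ (p / (p - 1)) = u r ^ (1 / (p - 1)) * u r := by
      rw [show p / (p-1) = 1/(p-1) + 1 by field_simp; ring,
        ENNReal.rpow_add_of_nonneg _ _ (by positivity) (by norm_num), ENNReal.rpow_one]
    have e2 : u r * LGD p φ r = LGG μ g (ENNReal.ofReal r) := by
      rw [hu]; simp only []
      rw [mul_assoc, ENNReal.inv_mul_cancel (h.D0 hr) (h.Dfin r hr), mul_one]
    change a * (u r ^ (p / (p - 1)) * LGD p φ r * LGn p φ r) = _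
    rw [e1, ← e2]
    simp only [hv]
    ring
  -- norm
  have hnorm : ∀ t, 0 < t → (ENNReal.ofReal t)⁻¹ * LGG μ F (ENNReal.ofReal t) ≤ LGK p φ 1 v t := by
    intro t ht
    exact (mul_le_mul_right (LGF_G μ hg hfin hmm t) _).trans (LG_K_eq v ht)
  have hK1 : ∫⁻ t in Ioi (0:ℝ), (LGK p φ 1 v t) ^ p * φ t ≤ 1 := by
    have := LG_H h p hp v hvm
    rw [div_self hp0.ne'] at this
    refine this.trans ?_
    have e : ∫⁻ r in Ioi (0:ℝ), v r ^ p * LGD p φ r * LGn p φ r = a ^ p * I := by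
      rw [hId]; unfold LGI
      rw [← lintegral_const_mul' _ _ (ENNReal.rpow_ne_top_of_nonneg hp0.le hat)]
      congr 1; funext r
      simp only [hv]
      rw [ENNReal.mul_rpow_of_nonneg _ _ hp0.le, ← ENNReal.rpow_mul (u r),
        show 1 / (p - 1) * p = p / (p - 1) by ring]
      ring
    rw [e, hap]
    calc LGCK p * (c⁻¹ * I) = (LGCK p * I) * c⁻¹ := by ring
      _ ≤ c * c⁻¹ := by
          refine mul_le_mul_left ?_ _
          rw [hc]; exact mul_le_mul_left le_self_add _
      _ ≤ 1 := ENNReal.mul_inv_le_one _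
  -- truncation
  have htr : ∀ N : ℕ, ∫⁻ x, min (F x) N * g x ∂μ ≤ B := by
    intro N
    have hne : ∀ x, min (F x) (N:ℝ≥0∞) ≠ ⊤ := fun x =>
      ne_top_of_le_ne_top (ENNReal.natCast_ne_top N) (min_le_right _ _)
    have en : ∀ x, ((‖(min (F x) (N:ℝ≥0∞)).toReal‖₊ : NNReal) : ℝ≥0∞) = min (F x) N := by
      intro x
      rw [← enorm_eq_nnnorm, Real.enorm_of_nonneg ENNReal.toReal_nonneg, ENNReal.ofReal_toReal (hne x)]
    have := hB (fun x => (min (F x) (N:ℝ≥0∞)).toReal)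
      ((hFm.min measurable_const).ennreal_toReal) ?_
    · simp_rw [en] at this; exact this
    · refine le_trans (setLIntegral_mono' measurableSet_Ioi fun t ht => ?_) hK1
      rw [LG_avg_eq μ _ ht]
      simp_rw [en]
      refine mul_le_mul_left (ENNReal.rpow_le_rpow (le_trans ?_ (hnorm t ht)) hp0.le) _
      exact mul_le_mul_right (LGG_mono_g μ (fun x => min_le_left _ _) _) _
  have hmain : a * I ≤ B := by
    refine hpair.trans ?_
    have : ∀ x, F x * g x = ⨆ N : ℕ, min (F x) (N:ℝ≥0∞) * g x := by
      intro x
      rw [← ENNReal.iSup_mul]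
      congr 1
      apply le_antisymm
      · refine le_of_forall_lt fun c hc => ?_
        obtain ⟨n, hn⟩ := ENNReal.exists_nat_gt hc.ne_top
        exact lt_of_lt_of_le (lt_min hc hn) (le_iSup (fun n : ℕ => min (F x) (n:ℝ≥0∞)) n)
      · exact iSup_le fun n => min_le_left _ _
    simp_rw [this]
    rw [lintegral_iSup (f := fun (n : ℕ) x => min (F x) (n:ℝ≥0∞) * g x)
      (fun n => (hFm.min measurable_const).mul hg)
      (fun i j hij x => mul_le_mul_left (min_le_min_left _ (by exact_mod_cast hij)) _)]
    exact iSup_le htr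
  calc I ^ (1 / (p / (p - 1))) = (LGCK p + 1) ^ (1 / p) * (a * I) := by
        have h1 : (LGCK p + 1) ≠ 0 := by simp
        have h2 : (LGCK p + 1) ≠ ⊤ := by simp [hCK]
        rw [ha, hc, ENNReal.mul_rpow_of_ne_top h2 hI, mul_assoc, ← mul_assoc,
          ← ENNReal.rpow_add _ _ h1 h2, add_neg_cancel, ENNReal.rpow_zero, one_mul]
        nth_rw 3 [← ENNReal.rpow_one I]
        rw [← ENNReal.rpow_add _ _ hI0 hI]
        congr 1
        field_simp
        ring
    _ ≤ _ := mul_le_mul_right hmain _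

theorem LG_lower2 (μ : Measure X) [SigmaFinite μ] (h : LGok p φ) {g : X → ℝ≥0∞} (hg : Measurable g)
    (B : ℝ≥0∞)
    (hB : ∀ f : X → ℝ, Measurable f → ∫⁻ t in Ioi 0, avgRearr μ f t ^ p * φ t ≤ 1 →
      ∫⁻ x, (‖f x‖₊ : ℝ≥0∞) * g x ∂μ ≤ B) :
    LGI μ p φ g ^ (1 / (p / (p - 1))) ≤ (LGCK p + 1) ^ (1 / p) * B := by
  have hp := h.hp
  have hp1 : 0 < p - 1 := by linarith
  have hp' : 0 < p / (p - 1) := div_pos h.p0 hp1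
  have hDm := LGD_meas (p := p) (φ := φ)
  have hnm := LGn_meas (p := p) (φ := φ)
  set gn : ℕ → X → ℝ≥0∞ := fun n => (spanningSets μ n).indicator (fun x => min (g x) n) with hgn
  have hgm : ∀ n, Measurable (gn n) := fun n =>
    (hg.min measurable_const).indicator (measurableSet_spanningSets μ n)
  have hle : ∀ n x, gn n x ≤ g x := fun n x =>
    (indicator_le_self _ _ _).trans (min_le_left _ _)
  have hmono : Monotone gn := by
    intro i j hij x
    simp only [hgn]
    by_cases hx : x ∈ spanningSets μ i
    · rw [indicator_of_mem hx, indicator_of_mem (monotone_spanningSets μ hij hx)]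
      exact min_le_min_left _ (by exact_mod_cast hij)
    · rw [indicator_of_notMem hx]; exact bot_le
  have hsup : ∀ x, ∀ c < g x, ∃ n, c < gn n x := by
    intro x c hc
    obtain ⟨n, hn⟩ := ENNReal.exists_nat_gt hc.ne_top
    have hx : x ∈ ⋃ n, spanningSets μ n := by rw [iUnion_spanningSets]; trivial
    obtain ⟨m, hm⟩ := mem_iUnion.1 hx
    refine ⟨max n m, ?_⟩
    simp only [hgn]
    rw [indicator_of_mem (monotone_spanningSets μ (le_max_right _ _) hm)]
    exact lt_min hc (hn.trans_le (by exact_mod_cast le_max_left _ _))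
  have hGsup : ∀ m, LGG μ g m = ⨆ n, LGG μ (gn n) m := by
    intro m
    unfold LGG
    rw [← lintegral_iSup (fun n => measurable_const.min (LGdist_anti μ (gn n)).measurable)
      (fun i j hij l => min_le_min_left _ (measure_mono fun x hx => lt_of_lt_of_le hx (hmono hij x)))]
    congr 1; funext l
    have hU : {x | ENNReal.ofReal l < g x} = ⋃ n, {x | ENNReal.ofReal l < gn n x} := by
      ext x
      simp only [mem_ofPred_eq, mem_iUnion]
      exact ⟨fun hx => hsup x _ hx, fun ⟨n, hn⟩ => hn.trans_le (hle n x)⟩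
    have hM : Monotone fun n => {x | ENNReal.ofReal l < gn n x} := fun i j hij x hx =>
      lt_of_lt_of_le hx (hmono hij x)
    rw [hU, hM.measure_iUnion]
    exact inf_iSup_eq _ _
  have hIsup : LGI μ p φ g = ⨆ n, LGI μ p φ (gn n) := by
    unfold LGI
    rw [← lintegral_iSup (f := fun n r => (LGG μ (gn n) (ENNReal.ofReal r) * (LGD p φ r)⁻¹) ^ (p / (p - 1)) *
        LGD p φ r * LGn p φ r) (fun n => (((((LGG_mono μ (gn n)).measurable.comp
      ENNReal.measurable_ofReal).mul hDm.inv).pow_const _).mul hDm).mul hnm)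
      (fun i j hij r => by
        simp only []
        gcongr
        exact LGG_mono_g μ (hmono hij) _)]
    congr 1; funext r
    rw [hGsup, ENNReal.iSup_mul]
    have := (ENNReal.orderIsoRpow (p / (p - 1)) hp').map_iSup
      (fun n => LGG μ (gn n) (ENNReal.ofReal r) * (LGD p φ r)⁻¹)
    simp only [ENNReal.orderIsoRpow_apply] at this
    rw [this, ENNReal.iSup_mul, ENNReal.iSup_mul]
  have hbd : ∀ n, LGI μ p φ (gn n) ^ (1 / (p / (p - 1))) ≤ (LGCK p + 1) ^ (1 / p) * B := by
    intro n
    have hs := (measure_spanningSets_lt_top μ n).ne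
    have hsub : {x | gn n x ≠ 0} ⊆ spanningSets μ n := by
      intro x hx
      by_contra hc
      exact hx (indicator_of_notMem hc _)
    have hN : ∀ x, gn n x ≤ n := fun x => (indicator_le_self _ _ _).trans (min_le_right _ _)
    apply LG_lower1 μ h (hgm n) (ne_top_of_le_ne_top hs (measure_mono hsub))
    · apply LG_I_fin μ h (hgm n) n hN
      simp only [hgn]
      rw [lintegral_indicator (measurableSet_spanningSets μ n)]
      apply ne_top_of_le_ne_top (ENNReal.mul_ne_top (ENNReal.natCast_ne_top n) hs)
      rw [← setLIntegral_const]
      exact lintegral_mono fun x => min_le_right _ _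
    · intro f hf hf1
      refine le_trans (lintegral_mono fun x => ?_) (hB f hf hf1)
      exact mul_le_mul_right (hle n x) _
  rw [hIsup]
  have := (ENNReal.orderIsoRpow (1 / (p / (p - 1))) (by positivity)).map_iSup
      (fun n => LGI μ p φ (gn n))
  simp only [ENNReal.orderIsoRpow_apply] at this
  rw [this]
  exact iSup_le hbd

theorem LG_lower3 (μ : Measure X) (hp0 : 0 < p) {g : X → ℝ≥0∞}
    (hΦ0 : ∫⁻ t in Ioi (0:ℝ), φ t ≠ 0) (B : ℝ≥0∞)
    (hB : ∀ f : X → ℝ, Measurable f → ∫⁻ t in Ioi 0, avgRearr μ f t ^ p * φ t ≤ 1 →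
      ∫⁻ x, (‖f x‖₊ : ℝ≥0∞) * g x ∂μ ≤ B) :
    (∫⁻ x, g x ∂μ) / (∫⁻ t in Ioi (0:ℝ), φ t) ^ (1 / p) ≤ B := by
  set Φ := ∫⁻ t in Ioi (0:ℝ), φ t with hΦ
  rcases eq_or_ne Φ ⊤ with ht | ht
  · rw [ht, ENNReal.top_rpow_of_pos (by positivity), ENNReal.div_top]; exact bot_le
  set d := (Φ ^ (1 / p))⁻¹ with hd
  have hdt : d ≠ ⊤ := by
    rw [hd, ENNReal.inv_ne_top]
    exact (ENNReal.rpow_pos (pos_iff_ne_zero.2 hΦ0) ht).ne'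
  have en : ((‖d.toReal‖₊ : NNReal) : ℝ≥0∞) = d := by
    rw [← enorm_eq_nnnorm, Real.enorm_of_nonneg ENNReal.toReal_nonneg, ENNReal.ofReal_toReal hdt]
  have := hB (fun _ => d.toReal) measurable_const ?_
  · simp_rw [en] at this
    rw [lintegral_const_mul' _ _ hdt] at this
    rw [div_eq_mul_inv, mul_comm]; exact this
  · calc _ ≤ ∫⁻ t in Ioi (0:ℝ), d ^ p * φ t := by
          apply setLIntegral_mono' measurableSet_Ioi
          intro t htt
          refine mul_le_mul_left (ENNReal.rpow_le_rpow ?_ hp0.le) _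
          rw [LG_avg_eq μ _ htt]
          simp_rw [en]
          have h2 : LGG μ (fun _ => d) (ENNReal.ofReal t) ≤ d * ENNReal.ofReal t := by
            calc _ ≤ ∫⁻ l in Ioi (0:ℝ), (Ioo (0:ℝ) d.toReal).indicator (fun _ => ENNReal.ofReal t) l := by
                  unfold LGG
                  apply setLIntegral_mono' measurableSet_Ioi
                  intro l hl
                  by_cases hlN : l < d.toReal
                  · rw [indicator_of_mem (by exact ⟨hl, hlN⟩)]; exact min_le_left _ _
                  · refine (min_le_right _ _).trans ?_
                    have : {x : X | ENNReal.ofReal l < d} = ∅ := by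
                      ext x
                      simp only [mem_ofPred_eq, mem_empty_iff_false, iff_false, not_lt]
                      rw [← ENNReal.ofReal_toReal hdt]
                      exact ENNReal.ofReal_le_ofReal (not_lt.1 hlN)
                    rw [this, measure_empty]; exact bot_le
              _ = _ := by
                  rw [lintegral_indicator measurableSet_Ioo, lintegral_const,
                    Measure.restrict_apply MeasurableSet.univ, univ_inter,
                    Measure.restrict_apply measurableSet_Ioo, inter_eq_left.2 Ioo_subset_Ioi_self]
                  simp [ENNReal.ofReal_toReal hdt, mul_comm]
          calc _ ≤ (ENNReal.ofReal t)⁻¹ * (d * ENNReal.ofReal t) := mul_le_mul_right h2 _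
            _ = d * ((ENNReal.ofReal t)⁻¹ * ENNReal.ofReal t) := by ring
            _ ≤ d := mul_le_of_le_one_right' (ENNReal.inv_mul_le_one _)
      _ = d ^ p * Φ := by
          rw [lintegral_const_mul' _ _ (ENNReal.rpow_ne_top_of_nonneg hp0.le hdt)]
      _ ≤ 1 := by
          rw [hd, ← ENNReal.rpow_neg, ← ENNReal.rpow_mul,
            show -(1/p)*p = -1 by field_simp, ENNReal.rpow_neg_one]
          exact ENNReal.inv_mul_le_one _
end
end

section
variable {X : Type*} [MeasurableSpace X] {p : ℝ}

theorem LG_dom_D {φ : ℝ → ℝ≥0∞} (F : ℝ → ℝ≥0∞) {t : ℝ} (ht : 0 < t) (A : ℝ≥0∞)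
    (hφ : Measurable φ)
    (h1 : ∀ s, 0 < s → s ≤ t → A ≤ F s)
    (h2 : ∀ s, t < s → A * (ENNReal.ofReal (t ^ p) * ENNReal.ofReal (s ^ (-p))) ≤ F s) :
    A * LGD p φ t ≤ ∫⁻ s in Ioi (0:ℝ), F s * φ s := by
  rw [← Ioc_union_Ioi_eq_Ioi ht.le, lintegral_union measurableSet_Ioi
    (by rw [Set.disjoint_left]; intro x hx hx'; exact absurd hx' (not_lt.2 hx.2)),
    ← restrict_Ioo_eq_restrict_Ioc]
  unfold LGD
  rw [mul_add]
  refine add_le_add ?_ ?_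
  · unfold intPhi
    rw [← lintegral_const_mul _ hφ]
    apply setLIntegral_mono' measurableSet_Ioo
    intro s hs
    exact mul_le_mul_left (h1 s hs.1 hs.2.le) _
  · unfold LGW LGtail
    rw [← mul_assoc, ← lintegral_const_mul _ (LGw_meas hφ)]
    apply setLIntegral_mono' measurableSet_Ioi
    intro s hs
    unfold LGw
    refine le_trans (le_of_eq ?_) (mul_le_mul_left (h2 s hs) _)
    ring

theorem LG_deg_Phi {φ : ℝ → ℝ≥0∞} (hp0 : 0 < p) (hφ : Measurable φ) {t : ℝ} (ht : 0 < t)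
    (hD : LGD p φ t = ⊤) : ∫⁻ s in Ioi (0:ℝ), φ s = ⊤ := by
  have := LG_dom_D (p := p) (φ := φ) (fun _ => 1) ht 1 hφ (fun _ _ _ => le_rfl) (fun s hs => by
    rw [one_mul, ← ENNReal.ofReal_mul (by positivity), ← ENNReal.ofReal_one]
    apply ENNReal.ofReal_le_ofReal
    have hs0 : 0 < s := ht.trans hs
    rw [Real.rpow_neg hs0.le, ← div_eq_mul_inv, div_le_one (by positivity)]
    exact Real.rpow_le_rpow ht.le hs.le hp0.le)
  simp only [one_mul, hD, top_le_iff] at this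
  exact this

theorem LG_deg_D {φ : ℝ → ℝ≥0∞} (hp0 : 0 < p) (hφ : Measurable φ) {t : ℝ} (ht : 0 < t)
    (hD : LGD p φ t = ⊤) : ∀ s, 0 < s → LGD p φ s = ⊤ := by
  intro s hs
  rcases le_total t s with h | h
  · exact top_le_iff.1 (hD ▸ LGD_mono hp0 hφ ht h)
  · have := LGE_anti hp0 hφ hs h
    rw [LGE_eq_D ht, hD, ENNReal.mul_top (by simp; positivity), top_le_iff] at this
    rw [LGD_eq_E hs, this, ENNReal.mul_top (by simp; positivity)]

theorem LG_deg_f {φ : ℝ → ℝ≥0∞} (hp0 : 0 < p) (hφ : Measurable φ)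
    (hD : ∀ s, 0 < s → LGD p φ s = ⊤) (μ : Measure X) [SFinite μ] {f : X → ℝ} (hf : Measurable f)
    (hf1 : ∫⁻ t in Ioi 0, avgRearr μ f t ^ p * φ t ≤ 1) (g : X → ℝ≥0∞) :
    ∫⁻ x, (‖f x‖₊ : ℝ≥0∞) * g x ∂μ = 0 := by
  have hfm : Measurable fun x => (‖f x‖₊ : ℝ≥0∞) := by fun_prop
  set G := LGG μ (fun x => (‖f x‖₊ : ℝ≥0∞)) with hG
  have hG0 : ∀ t, 0 < t → G (ENNReal.ofReal t) = 0 := by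
    intro t ht
    have ht0 : ENNReal.ofReal t ≠ 0 := by simp [ht]
    by_contra hne
    have := LG_dom_D (p := p) (φ := φ) (fun s => avgRearr μ f s ^ p) ht
      (((ENNReal.ofReal t)⁻¹ * G (ENNReal.ofReal t)) ^ p) hφ ?_ ?_
    · rw [hD t ht, ENNReal.mul_top] at this
      · exact absurd (this.trans hf1) (by simp)
      · intro h0
        rw [ENNReal.rpow_eq_zero_iff_of_pos hp0, mul_eq_zero] at h0
        rcases h0 with h0 | h0
        · simp at h0
        · exact hne h0
    · intro s hs hst
      refine ENNReal.rpow_le_rpow ?_ hp0.le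
      rw [LG_avg_eq μ f hs]
      have hs0 : ENNReal.ofReal s ≠ 0 := by simp [hs]
      have hq := LGG_qc μ (fun x => (‖f x‖₊ : ℝ≥0∞)) (ENNReal.ofReal_le_ofReal hst)
      rw [← hG] at hq ⊢
      calc (ENNReal.ofReal t)⁻¹ * G (ENNReal.ofReal t) =
          (ENNReal.ofReal t)⁻¹ * (ENNReal.ofReal s)⁻¹ * (ENNReal.ofReal s * G (ENNReal.ofReal t)) := by
            rw [mul_assoc, ← mul_assoc (ENNReal.ofReal s)⁻¹, ENNReal.inv_mul_cancel hs0 (by simp), one_mul]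
        _ ≤ (ENNReal.ofReal t)⁻¹ * (ENNReal.ofReal s)⁻¹ * (ENNReal.ofReal t * G (ENNReal.ofReal s)) :=
            mul_le_mul_right hq _
        _ = ((ENNReal.ofReal t)⁻¹ * ENNReal.ofReal t) * ((ENNReal.ofReal s)⁻¹ * G (ENNReal.ofReal s)) := by ring
        _ = _ := by rw [ENNReal.inv_mul_cancel ht0 (by simp), one_mul]
    · intro s hs
      have hs0 : 0 < s := ht.trans hs
      rw [← ENNReal.ofReal_rpow_of_pos ht]
      have e : ENNReal.ofReal (s ^ (-p)) = ((ENNReal.ofReal s)⁻¹) ^ p := by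
        rw [← ENNReal.ofReal_inv_of_pos hs0, ENNReal.ofReal_rpow_of_pos (by positivity),
          Real.rpow_neg hs0.le, Real.inv_rpow hs0.le]
      rw [e, ← ENNReal.mul_rpow_of_nonneg _ _ hp0.le, ← ENNReal.mul_rpow_of_nonneg _ _ hp0.le]
      refine ENNReal.rpow_le_rpow ?_ hp0.le
      rw [LG_avg_eq μ f hs0, ← hG]
      calc _ = ((ENNReal.ofReal t)⁻¹ * ENNReal.ofReal t) * ((ENNReal.ofReal s)⁻¹ * G (ENNReal.ofReal t)) := by ring
        _ = (ENNReal.ofReal s)⁻¹ * G (ENNReal.ofReal t) := by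
            rw [ENNReal.inv_mul_cancel ht0 (by simp), one_mul]
        _ ≤ _ := mul_le_mul_right (LGG_mono _ _ (ENNReal.ofReal_le_ofReal hs.le)) _
  have hint : ∫⁻ x, (‖f x‖₊ : ℝ≥0∞) ∂μ = 0 := by
    rw [← LGG_top μ hfm, LGG_sup, ← hG]
    simp only [ENNReal.iSup_eq_zero]
    intro n
    rw [← ENNReal.ofReal_natCast]
    apply le_antisymm _ bot_le
    refine le_trans (LGG_mono _ _ (ENNReal.ofReal_le_ofReal (show (n:ℝ) ≤ n + 1 by linarith))) ?_
    rw [← hG, hG0 _ (by positivity)]; exact le_rfl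
  rw [lintegral_eq_zero_iff hfm] at hint
  rw [← lintegral_zero (μ := μ)]
  apply lintegral_congr_ae
  filter_upwards [hint] with x hx
  rw [hx]; simp

theorem LG_Ib_meas (b : ℝ≥0∞) : MeasurableSet (IbSet b) :=
  measurableSet_Ioi.inter (measurableSet_lt ENNReal.measurable_ofReal measurable_const)

theorem LG_Ib_int (b : ℝ≥0∞) (φ F : ℝ → ℝ≥0∞) :
    ∫⁻ t in Ioi (0:ℝ), F t * (IbSet b).indicator φ t = ∫⁻ t in IbSet b, F t * φ t := by
  have : ∀ t, F t * (IbSet b).indicator φ t = (IbSet b).indicator (fun t => F t * φ t) t := by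
    intro t
    by_cases h : t ∈ IbSet b
    · rw [indicator_of_mem h, indicator_of_mem h]
    · rw [indicator_of_notMem h, indicator_of_notMem h, mul_zero]
  simp_rw [this]
  rw [setLIntegral_indicator (LG_Ib_meas b), inter_eq_left.2 (fun x hx => hx.1)]

theorem LG_Ib_V (b : ℝ≥0∞) (φ : ℝ → ℝ≥0∞) {t : ℝ} (ht : t ∈ IbSet b) :
    intPhi ((IbSet b).indicator φ) t = intPhi φ t := by
  unfold intPhi
  apply setLIntegral_congr_fun measurableSet_Ioo
  intro s hs
  exact indicator_of_mem (show s ∈ IbSet b from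
    ⟨hs.1, lt_of_le_of_lt (ENNReal.ofReal_le_ofReal hs.2.le) ht.2⟩) _

theorem LG_Ib_W (b : ℝ≥0∞) (φ : ℝ → ℝ≥0∞) {t : ℝ} (ht : 0 ≤ t) :
    LGW p ((IbSet b).indicator φ) t = tailP b p φ t := by
  unfold LGW LGtail LGw tailP
  have : ∀ s, (IbSet b).indicator φ s * ENNReal.ofReal (s ^ (-p)) =
      (IbSet b).indicator (fun s => φ s * ENNReal.ofReal (s ^ (-p))) s := by
    intro t
    by_cases h : t ∈ IbSet b
    · rw [indicator_of_mem h, indicator_of_mem h]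
    · rw [indicator_of_notMem h, indicator_of_notMem h, zero_mul]
  simp_rw [this]
  rw [setLIntegral_indicator (LG_Ib_meas b)]
  congr 2
  ext s
  constructor
  · rintro ⟨h1, h2⟩; exact ⟨h2, h1.2⟩
  · rintro ⟨h1, h2⟩; exact ⟨⟨ht.trans_lt h1, h2⟩, h1⟩

theorem LG_Ib_D (b : ℝ≥0∞) (φ : ℝ → ℝ≥0∞) {t : ℝ} (ht : t ∈ IbSet b) :
    LGD p ((IbSet b).indicator φ) t = DPhi b p φ t := by
  unfold LGD DPhi
  rw [LG_Ib_V b φ ht, LG_Ib_W b φ ht.1.le]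

theorem LG_Ib_I (b : ℝ≥0∞) (φ : ℝ → ℝ≥0∞) (μ : Measure X)
    (h : LGok p ((IbSet b).indicator φ)) (g : X → ℝ) :
    LGI μ p ((IbSet b).indicator φ) (fun x => (‖g x‖₊ : ℝ≥0∞)) =
      ∫⁻ t in IbSet b, (avgRearr μ g t) ^ (p / (p - 1)) * dualWeight b p φ t := by
  have hp := h.hp
  have hp1 : 0 < p - 1 := by linarith
  have hp' : 0 < p / (p - 1) := div_pos h.p0 hp1
  rw [← LG_Ib_int]
  unfold LGI
  apply setLIntegral_congr_fun measurableSet_Ioi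
  intro r hr
  have hr0 : 0 < r := hr
  simp only []
  by_cases hrb : r ∈ IbSet b
  · rw [indicator_of_mem hrb, LG_avg_eq μ g hr0]
    have hD0 := h.D0 hr0
    have hDt := h.Dfin r hr0
    unfold LGn dualWeight
    rw [LG_Ib_V b φ hrb, LG_Ib_W b φ hr0.le, LG_Ib_D b φ hrb]
    rw [LG_Ib_D b φ hrb] at hD0 hDt
    set D := DPhi b p φ r
    set V := intPhi φ r
    set W := tailP b p φ r
    set G := LGG μ (fun x => (‖g x‖₊ : ℝ≥0∞)) (ENNReal.ofReal r)
    rw [ENNReal.mul_rpow_of_nonneg _ _ hp'.le, ENNReal.mul_rpow_of_nonneg _ _ hp'.le, div_eq_mul_inv (_ : ℝ≥0∞)]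
    have e1 : (D⁻¹) ^ (p / (p - 1)) * D * D ^ (-2 : ℝ) = (D ^ (p / (p - 1) + 1))⁻¹ := by
      rw [← ENNReal.rpow_neg_one, ← ENNReal.rpow_mul, ← ENNReal.rpow_neg]
      nth_rw 2 [← ENNReal.rpow_one D]
      rw [← ENNReal.rpow_add _ _ hD0 hDt, ← ENNReal.rpow_add _ _ hD0 hDt]
      congr 1; ring
    have e2 : ((ENNReal.ofReal r)⁻¹) ^ (p / (p - 1)) * ENNReal.ofReal (r ^ (p + p / (p - 1) - 1)) =
        ENNReal.ofReal (r ^ (p - 1)) := by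
      rw [← ENNReal.ofReal_inv_of_pos hr0, ENNReal.ofReal_rpow_of_pos (by positivity),
        ← ENNReal.ofReal_mul (by positivity), Real.inv_rpow hr0.le, ← Real.rpow_neg hr0.le,
        ← Real.rpow_add hr0]
      congr 2; ring
    calc _ = G ^ (p / (p - 1)) * (V * W) * ENNReal.ofReal (r ^ (p - 1)) *
          ((D⁻¹) ^ (p / (p - 1)) * D * D ^ (-2 : ℝ)) := by ring
      _ = _ := by rw [e1, ← e2]; ring
  · rw [indicator_of_notMem hrb, mul_zero]
    have hW : LGW p ((IbSet b).indicator φ) r = 0 := by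
      rw [LG_Ib_W b φ hr0.le]
      unfold tailP
      have : {s : ℝ | r < s ∧ ENNReal.ofReal s < b} = ∅ := by
        ext s
        simp only [mem_ofPred_eq, mem_empty_iff_false, iff_false]
        rintro ⟨h1, h2⟩
        exact hrb ⟨hr0, lt_of_le_of_lt (ENNReal.ofReal_le_ofReal h1.le) h2⟩
      rw [this]; simp
    unfold LGn
    rw [hW]; simp

theorem LG_Ib_rho (b : ℝ≥0∞) (φ : ℝ → ℝ≥0∞) (μ : Measure X) (hp0 : 0 < p) (f : X → ℝ) :
    rhoGamma μ b p φ f ≤ 1 ↔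
      ∫⁻ t in Ioi 0, avgRearr μ f t ^ p * (IbSet b).indicator φ t ≤ 1 := by
  rw [LG_Ib_int]
  unfold rhoGamma
  conv_lhs => rw [← ENNReal.one_rpow (1 / p)]
  exact ENNReal.rpow_le_rpow_iff (by positivity)

theorem LG_const (K : ℝ≥0∞) (hK : K ≠ ⊤) : ∃ c : ℝ, 0 < c ∧ K ≤ ENNReal.ofReal c :=
  ⟨K.toReal + 1, by positivity, by
    nth_rw 1 [← ENNReal.ofReal_toReal hK]
    exact ENNReal.ofReal_le_ofReal (by linarith)⟩
end

section
theorem LG_final {X : Type*} [MeasurableSpace X] (μ : Measure X) [SigmaFinite μ]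
    (b : ℝ≥0∞) (hb : 0 < b) (p : ℝ) (hp : 1 < p)
    (φ : ℝ → ℝ≥0∞) (hφ : IsNontrivialWeight b p φ) :
    ∃ c C : ℝ, 0 < c ∧ 0 < C ∧ ∀ g : X → ℝ, Measurable g →
      ENNReal.ofReal c *
          (rhoGamma μ b (p / (p - 1)) (dualWeight b p φ) g +
            (∫⁻ x, (‖g x‖₊ : ℝ≥0∞) ∂μ) / (∫⁻ t in IbSet b, φ t) ^ (1 / p)) ≤
        (⨆ (f : X → ℝ) (_ : Measurable f) (_ : rhoGamma μ b p φ f ≤ 1),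
          ∫⁻ x, (‖f x‖₊ : ℝ≥0∞) * (‖g x‖₊ : ℝ≥0∞) ∂μ) ∧
      (⨆ (f : X → ℝ) (_ : Measurable f) (_ : rhoGamma μ b p φ f ≤ 1),
          ∫⁻ x, (‖f x‖₊ : ℝ≥0∞) * (‖g x‖₊ : ℝ≥0∞) ∂μ) ≤
        ENNReal.ofReal C *
          (rhoGamma μ b (p / (p - 1)) (dualWeight b p φ) g +
            (∫⁻ x, (‖g x‖₊ : ℝ≥0∞) ∂μ) / (∫⁻ t in IbSet b, φ t) ^ (1 / p)) := by
  obtain ⟨⟨hφm, hφpos, -⟩, -, hW0⟩ := hφ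
  have hp0 : 0 < p := by linarith
  have hp1 : 0 < p - 1 := by linarith
  have hp' : 1 < p / (p - 1) := by rw [lt_div_iff₀ hp1]; linarith
  set φt := (IbSet b).indicator φ with hφt
  have hφtm : Measurable φt := hφm.indicator (LG_Ib_meas b)
  have hΦ : ∫⁻ t in IbSet b, φ t = ∫⁻ t in Ioi (0:ℝ), φt t := by
    have := LG_Ib_int b φ (fun _ => 1)
    simp only [one_mul] at this
    exact this.symm
  by_cases hdeg : ∃ t, 0 < t ∧ LGD p φt t = ⊤
  · obtain ⟨t0, ht0, hD0⟩ := hdeg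
    have hD := LG_deg_D hp0 hφtm ht0 hD0
    have hΦt := LG_deg_Phi hp0 hφtm ht0 hD0
    refine ⟨1, 1, one_pos, one_pos, fun g hg => ⟨?_, ?_⟩⟩
    · have h1 : rhoGamma μ b (p / (p - 1)) (dualWeight b p φ) g = 0 := by
        unfold rhoGamma
        have : ∫⁻ t in IbSet b, (avgRearr μ g t) ^ (p / (p - 1)) * dualWeight b p φ t = 0 := by
          rw [← lintegral_zero (μ := volume.restrict (IbSet b))]
          apply setLIntegral_congr_fun (LG_Ib_meas b)
          intro t ht
          simp only []
          unfold dualWeight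
          rw [← LG_Ib_D b φ ht, hD t ht.1, ENNReal.top_rpow_of_pos (by linarith), ENNReal.div_top,
            mul_zero]
        rw [this, ENNReal.zero_rpow_of_pos (by positivity)]
      rw [h1, hΦ, hΦt, ENNReal.top_rpow_of_pos (by positivity), ENNReal.div_top]
      simp
    · refine iSup_le fun f => iSup_le fun hf => iSup_le fun hf1 => ?_
      rw [LG_deg_f hp0 hφtm hD μ hf ((LG_Ib_rho b φ μ hp0 f).1 hf1)]
      exact bot_le
  · have hVpos : ∀ t, 0 < t → intPhi φt t ≠ 0 := by
      intro t ht
      obtain ⟨s, -, hs1, hs2⟩ := ENNReal.lt_iff_exists_real_btwn.1 hb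
      have hs0 : 0 < s := ENNReal.ofReal_pos.1 hs1
      have hm : min s t ∈ IbSet b :=
        ⟨lt_min hs0 ht, lt_of_le_of_lt (ENNReal.ofReal_le_ofReal (min_le_left _ _)) hs2⟩
      intro h0
      have h1 : intPhi φt (min s t) = 0 :=
        le_antisymm ((LG_intPhi_mono φt (min_le_right s t)).trans h0.le) bot_le
      rw [LG_Ib_V b φ hm] at h1
      unfold intPhi at h1
      rw [setLIntegral_eq_zero_iff measurableSet_Ioo hφm] at h1
      have h2 : volume (Ioo (0:ℝ) (min s t)) = 0 := by
        refine measure_mono_null ?_ (ae_iff.1 h1)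
        intro x hx
        simp only [mem_ofPred_eq, Classical.not_imp]
        exact ⟨hx, (hφpos x ⟨hx.1, lt_of_le_of_lt (ENNReal.ofReal_le_ofReal hx.2.le) hm.2⟩).1.ne'⟩
      rw [Real.volume_Ioo, ENNReal.ofReal_eq_zero] at h2
      have := hm.1
      linarith
    have hok : LGok p φt := by
      refine ⟨hp, hφtm, fun t ht hc => hdeg ⟨t, ht, hc⟩, hVpos, ?_⟩
      rw [LG_Ib_W b φ le_rfl, hW0]
    have hΦ0 : ∫⁻ t in Ioi (0:ℝ), φt t ≠ 0 := fun h0 =>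
      hVpos 1 one_pos (le_antisymm ((lintegral_mono_set Ioo_subset_Ioi_self).trans h0.le) bot_le)
    have hr : ∀ g : X → ℝ, rhoGamma μ b (p / (p - 1)) (dualWeight b p φ) g =
        LGI μ p φt (fun x => (‖g x‖₊ : ℝ≥0∞)) ^ (1 / (p / (p - 1))) := by
      intro g
      rw [LG_Ib_I b φ μ hok g]; rfl
    set K1 := (LGCK p + 1) ^ (1 / p) with hK1
    have hK1t : K1 ≠ ⊤ := ENNReal.rpow_ne_top_of_nonneg (by positivity) (by simp [LGCK_fin p hp])
    set K2 := LGCK (p / (p - 1)) ^ (1 / (p / (p - 1))) with hK2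
    have hK2t : K2 ≠ ⊤ := ENNReal.rpow_ne_top_of_nonneg (by positivity) (LGCK_fin _ hp')
    obtain ⟨k, hk0, hk⟩ := LG_const (K1 + 1) (by simp [hK1t])
    obtain ⟨C, hC0, hC⟩ := LG_const (LGCL p * (K2 + 1)) (ENNReal.mul_ne_top (LGCL_fin p) (by simp [hK2t]))
    refine ⟨k⁻¹, C, inv_pos.2 hk0, hC0, fun g hg => ?_⟩
    have hgm : Measurable fun x => (‖g x‖₊ : ℝ≥0∞) := by fun_prop
    rw [hr g, hΦ]
    set I := LGI μ p φt (fun x => (‖g x‖₊ : ℝ≥0∞)) ^ (1 / (p / (p - 1))) with hI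
    set J := (∫⁻ x, (‖g x‖₊ : ℝ≥0∞) ∂μ) / (∫⁻ t in Ioi (0:ℝ), φt t) ^ (1 / p) with hJ
    constructor
    · set B := ⨆ (f : X → ℝ) (_ : Measurable f) (_ : rhoGamma μ b p φ f ≤ 1),
          ∫⁻ x, (‖f x‖₊ : ℝ≥0∞) * (‖g x‖₊ : ℝ≥0∞) ∂μ with hB
      have hBf : ∀ f : X → ℝ, Measurable f → ∫⁻ t in Ioi 0, avgRearr μ f t ^ p * φt t ≤ 1 →
          ∫⁻ x, (‖f x‖₊ : ℝ≥0∞) * (‖g x‖₊ : ℝ≥0∞) ∂μ ≤ B := by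
        intro f hf hf1
        exact le_iSup_of_le f (le_iSup_of_le hf (le_iSup_of_le ((LG_Ib_rho b φ μ hp0 f).2 hf1) le_rfl))
      have h1 : I ≤ K1 * B := LG_lower2 μ hok hgm B hBf
      have h2 : J ≤ B := LG_lower3 μ hp0 hΦ0 B hBf
      calc ENNReal.ofReal k⁻¹ * (I + J) ≤ ENNReal.ofReal k⁻¹ * (K1 * B + B) :=
            mul_le_mul_right (add_le_add h1 h2) _
        _ = ENNReal.ofReal k⁻¹ * ((K1 + 1) * B) := by ring
        _ ≤ ENNReal.ofReal k⁻¹ * (ENNReal.ofReal k * B) :=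
            mul_le_mul_right (mul_le_mul_left hk _) _
        _ = B := by
            rw [← mul_assoc, ← ENNReal.ofReal_mul (by positivity), inv_mul_cancel₀ hk0.ne']
            simp
    · refine iSup_le fun f => iSup_le fun hf => iSup_le fun hf1 => ?_
      have hf2 := (LG_Ib_rho b φ μ hp0 f).1 hf1
      refine (LG_upper2 μ hok hgm hf).trans ?_
      have h1 : (∫⁻ t in Ioi 0, avgRearr μ f t ^ p * φt t) ^ (1 / p) ≤ 1 :=
        ENNReal.rpow_le_one hf2 (by positivity)
      calc _ ≤ LGCL p * (1 * (K2 * I + J)) := mul_le_mul_right (mul_le_mul_left h1 _) _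
        _ ≤ LGCL p * ((K2 + 1) * (I + J)) := by
            rw [one_mul]
            refine mul_le_mul_right ?_ _
            calc K2 * I + J ≤ K2 * I + J + (I + K2 * J) := le_self_add
              _ = _ := by ring
        _ = LGCL p * (K2 + 1) * (I + J) := by ring
        _ ≤ _ := mul_le_mul_left hC _
end

theorem statement0 {X : Type*} [MeasurableSpace X] (μ : Measure X) [SigmaFinite μ]
    (b : ℝ≥0∞) (hb : 0 < b) (hμ : μ univ = b) (p : ℝ) (hp : 1 < p)
    (φ : ℝ → ℝ≥0∞) (hφ : IsNontrivialWeight b p φ) :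
    ∃ c C : ℝ, 0 < c ∧ 0 < C ∧ ∀ g : X → ℝ, Measurable g →
      ENNReal.ofReal c *
          (rhoGamma μ b (p / (p - 1)) (dualWeight b p φ) g +
            (∫⁻ x, (‖g x‖₊ : ℝ≥0∞) ∂μ) / (∫⁻ t in IbSet b, φ t) ^ (1 / p)) ≤
        (⨆ (f : X → ℝ) (_ : Measurable f) (_ : rhoGamma μ b p φ f ≤ 1),
          ∫⁻ x, (‖f x‖₊ : ℝ≥0∞) * (‖g x‖₊ : ℝ≥0∞) ∂μ) ∧
      (⨆ (f : X → ℝ) (_ : Measurable f) (_ : rhoGamma μ b p φ f ≤ 1),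
          ∫⁻ x, (‖f x‖₊ : ℝ≥0∞) * (‖g x‖₊ : ℝ≥0∞) ∂μ) ≤
        ENNReal.ofReal C *
          (rhoGamma μ b (p / (p - 1)) (dualWeight b p φ) g +
            (∫⁻ x, (‖g x‖₊ : ℝ≥0∞) ∂μ) / (∫⁻ t in IbSet b, φ t) ^ (1 / p)) := by
  exact LG_final μ b hb p hp φ hφ

end
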